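/- Let Λ : ℕ → ℝ be the increasing enumeration of the eigenvalues of the problem (α,β) with α = 0 and β = 2/b, and let M : ℕ → ℝ be the increasing enumeration of the eigenvalues of the problem (α,β) with α = 0 and β = 2a/b. Then for every n ∈ ℕ one has Λ(κ·n) = (κ/a³)·M(n). -/

import Mathlib

open Set Filter

/-- First derivative on `[0,1]` (one-sided at the endpoints). -/
noncomputable def Y1 (y : ℝ → ℝ) : ℝ → ℝ := derivWithin y (Set.Icc 0 1)
/-- Second derivative on `[0,1]`. -/
noncomputable def Y2 (y : ℝ → ℝ) : ℝ → ℝ := iteratedDerivWithin 2 y (Set.Icc 0 1)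
/-- Third derivative on `[0,1]`. -/
noncomputable def Y3 (y : ℝ → ℝ) : ℝ → ℝ := iteratedDerivWithin 3 y (Set.Icc 0 1)

/-- `y` is a solution on `[0,1]` of `[y''' - λ P y]' + λ P y' = 0`:
`y ∈ C³[0,1]` and `y''' - λ P y` is (continuously) differentiable on `[0,1]`
with derivative `-λ P y'`. -/
def SolutionOn (P : ℝ → ℝ) (lam : ℝ) (y : ℝ → ℝ) : Prop :=
  ContDiffOn ℝ 3 y (Set.Icc 0 1) ∧
  ∀ x ∈ Set.Icc (0:ℝ) 1,
    HasDerivWithinAt (fun t => Y3 y t - lam * P t * y t)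
      (-(lam * P x * Y1 y x)) (Set.Icc 0 1) x

/-- `y` is not identically zero on `[0,1]`. -/
def Nontrivial01 (y : ℝ → ℝ) : Prop := ∃ x ∈ Set.Icc (0:ℝ) 1, y x ≠ 0

/-- The boundary conditions of the problem `(α, β)`. -/
def BC (α β : ℝ) (y : ℝ → ℝ) : Prop :=
  Y2 y 0 + α * y 0 - β * Y1 y 0 = 0 ∧
  -β * Y3 y 0 + α * Y2 y 0 = 0 ∧
  Y2 y 1 + α * y 1 + β * Y1 y 1 = 0 ∧
  -β * Y3 y 1 - α * Y2 y 1 = 0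

/-- `y` is an eigenfunction of the problem `(α, β)` with eigenvalue `lam`. -/
def Eigenfunction (P : ℝ → ℝ) (α β lam : ℝ) (y : ℝ → ℝ) : Prop :=
  Nontrivial01 y ∧ SolutionOn P lam y ∧ BC α β y

/-- `lam` is an eigenvalue of the problem `(α, β)`. -/
def IsEigenvalue (P : ℝ → ℝ) (α β lam : ℝ) : Prop :=
  ∃ y : ℝ → ℝ, Eigenfunction P α β lam y

/-- The number `b = (1 - κ a)/(κ - 1)`. -/
noncomputable def bb (κ : ℕ) (a : ℝ) : ℝ := (1 - κ * a) / (κ - 1)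

/-- `P` is a nondecreasing continuous function on `[0,1]` with `P 0 = 0`, `P 1 = 1`,
self-similar of Cantor type with parameters `κ ≥ 2` and `0 < a < 1/κ`. -/
def CantorSelfSimilar (P : ℝ → ℝ) (κ : ℕ) (a : ℝ) : Prop :=
  ContinuousOn P (Set.Icc 0 1) ∧ MonotoneOn P (Set.Icc 0 1) ∧
  P 0 = 0 ∧ P 1 = 1 ∧ 2 ≤ κ ∧ 0 < a ∧ a < 1 / κ ∧
  (∀ k : ℕ, k < κ → ∃ c : ℝ, ∀ x ∈ Set.Icc (0:ℝ) 1,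
      (κ : ℝ) * P (k * (a + bb κ a) + a * x) = P x + c) ∧
  (∀ k : ℕ, 1 ≤ k → k < κ →
      ∀ x ∈ Set.Ioo ((k:ℝ) * (a + bb κ a) - bb κ a) ((k:ℝ) * (a + bb κ a)),
      ∀ x' ∈ Set.Ioo ((k:ℝ) * (a + bb κ a) - bb κ a) ((k:ℝ) * (a + bb κ a)),
      P x = P x')

/-- The consequences of the self-similarity hypotheses used by the oscillation theory. -/
structure SymmetricWeight (P : ℝ → ℝ) : Prop where
  cont : ContinuousOn P (Icc 0 1)
  mono : MonotoneOn P (Icc 0 1)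
  zero : P 0 = 0
  one : P 1 = 1
  symm : ∀ x ∈ Icc (0:ℝ) 1, P (1 - x) = 1 - P x
  pos : ∀ x ∈ Ioc (0:ℝ) 1, 0 < P x

namespace SymmetricWeight

variable {P : ℝ → ℝ}

lemma nonneg (hP : SymmetricWeight P) {x : ℝ} (hx : x ∈ Icc (0:ℝ) 1) : 0 ≤ P x := by
  rw [← hP.zero]
  exact hP.mono (by simp) hx hx.1

lemma le_one (hP : SymmetricWeight P) {x : ℝ} (hx : x ∈ Icc (0:ℝ) 1) : P x ≤ 1 := by
  rw [← hP.one]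
  exact hP.mono hx (by simp) hx.2

lemma abs_le_one (hP : SymmetricWeight P) {x : ℝ} (hx : x ∈ Icc (0:ℝ) 1) : |P x| ≤ 1 := by
  rw [abs_of_nonneg (hP.nonneg hx)]
  exact hP.le_one hx

lemma lt_one (hP : SymmetricWeight P) {x : ℝ} (hx : x ∈ Ico (0:ℝ) 1) : P x < 1 := by
  have h1 := hP.symm x ⟨hx.1, hx.2.le⟩
  have h2 := hP.pos (1 - x) ⟨by linarith [hx.2], by linarith [hx.1]⟩
  linarith

end SymmetricWeight

/-- The vector field of the first-order system equivalent to `y⁗ = λ P' y`, in the variables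
`(y, y', y'', y''' / λ - P y)`. -/
def beamField (P : ℝ → ℝ) (lam x : ℝ) (v : Fin 4 → ℝ) : Fin 4 → ℝ :=
  ![v 1, v 2, lam * (P x * v 0 + v 3), -(P x * v 1)]

/-- A solution on `[0,1]` of the first-order system. -/
def BeamSol (P : ℝ → ℝ) (lam : ℝ) (s : ℝ → Fin 4 → ℝ) : Prop :=
  ∀ x ∈ Icc (0:ℝ) 1, HasDerivWithinAt s (beamField P lam x (s x)) (Icc 0 1) x

/-- The quantity `y''' / λ` of a solution, that is, the integral of `y` against `dP`. -/
def shear (P : ℝ → ℝ) (s : ℝ → Fin 4 → ℝ) (x : ℝ) : ℝ := P x * s x 0 + s x 3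

lemma beamField_sub (P : ℝ → ℝ) (lam x : ℝ) (v w : Fin 4 → ℝ) :
    beamField P lam x (v - w) = beamField P lam x v - beamField P lam x w := by
  ext i
  fin_cases i <;> simp [beamField] <;> ring

lemma norm_beamField_le {P : ℝ → ℝ} (hP : SymmetricWeight P) (lam : ℝ) {x : ℝ}
    (hx : x ∈ Icc (0:ℝ) 1) (v : Fin 4 → ℝ) :
    ‖beamField P lam x v‖ ≤ (1 + 2 * |lam|) * ‖v‖ := by
  have hv : ∀ i, |v i| ≤ ‖v‖ := fun i => norm_le_pi_norm v i
  have hn : 0 ≤ ‖v‖ := norm_nonneg v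
  have hl : 0 ≤ |lam| := abs_nonneg lam
  have hp := hP.abs_le_one hx
  have hpv : ∀ i, |P x * v i| ≤ ‖v‖ := fun i => by
    rw [abs_mul]
    calc |P x| * |v i| ≤ 1 * ‖v‖ := mul_le_mul hp (hv i) (abs_nonneg _) zero_le_one
      _ = ‖v‖ := one_mul _
  rw [pi_norm_le_iff_of_nonneg (by positivity)]
  have hln : 0 ≤ |lam| * ‖v‖ := by positivity
  intro i
  fin_cases i
  · simp only [beamField, Real.norm_eq_abs]
    have := hv 1
    simp
    nlinarith
  · simp only [beamField, Real.norm_eq_abs]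
    have := hv 2
    simp
    nlinarith
  · simp only [beamField, Real.norm_eq_abs]
    have h1 := hpv 0
    have h2 := hv 3
    have h3 := abs_add_le (P x * v 0) (v 3)
    have h4 : |lam * (P x * v 0 + v 3)| ≤ |lam| * (2 * ‖v‖) := by
      rw [abs_mul]
      exact mul_le_mul_of_nonneg_left (by linarith) hl
    simp
    nlinarith
  · simp only [beamField, Real.norm_eq_abs]
    have := hpv 1
    simp only [Fin.isValue, Fin.reduceFinMk, Matrix.cons_val, abs_neg]
    nlinarith

/-- Coordinatewise truncation to `[-R, R]`. -/
def truncate (R : ℝ) (v : Fin 4 → ℝ) : Fin 4 → ℝ := fun i => max (-R) (min (v i) R)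

lemma norm_truncate_sub_le (R : ℝ) (v w : Fin 4 → ℝ) :
    ‖truncate R v - truncate R w‖ ≤ ‖v - w‖ := by
  rw [pi_norm_le_iff_of_nonneg (norm_nonneg _)]
  intro i
  have h1 : |min (v i) R - min (w i) R| ≤ |v i - w i| := by
    have := abs_min_sub_min_le_max (v i) R (w i) R
    simpa using this
  have h2 := abs_max_sub_max_le_max (-R) (min (v i) R) (-R) (min (w i) R)
  have h3 : |v i - w i| ≤ ‖v - w‖ := norm_le_pi_norm (v - w) i
  simp only [truncate, Pi.sub_apply, Real.norm_eq_abs]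
  refine h2.trans ?_
  simp only [sub_self, abs_zero]
  exact max_le (norm_nonneg _) (h1.trans h3)

lemma norm_truncate_le {R : ℝ} (hR : 0 ≤ R) (v : Fin 4 → ℝ) : ‖truncate R v‖ ≤ R := by
  rw [pi_norm_le_iff_of_nonneg hR]
  intro i
  rw [Real.norm_eq_abs, abs_le]
  exact ⟨le_max_left _ _, max_le (by linarith) (min_le_right _ _)⟩

lemma truncate_eq_self {R : ℝ} {v : Fin 4 → ℝ} (hv : ‖v‖ ≤ R) : truncate R v = v := by
  ext i
  have h := abs_le.1 ((norm_le_pi_norm v i).trans hv)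
  simp [truncate, min_eq_left h.2, max_eq_right h.1]

lemma norm_truncate_le_norm {R : ℝ} (hR : 0 ≤ R) (v : Fin 4 → ℝ) : ‖truncate R v‖ ≤ ‖v‖ := by
  have := norm_truncate_sub_le R v 0
  rwa [truncate_eq_self (v := 0) (by simpa using hR), sub_zero, sub_zero] at this

lemma hasDerivWithinAt_Ici_of_Icc {E : Type*} [NormedAddCommGroup E] [NormedSpace ℝ E]
    {f : ℝ → E} {f' : E} {x : ℝ} (hx : x ∈ Ico (0:ℝ) 1)
    (h : HasDerivWithinAt f f' (Icc 0 1) x) : HasDerivWithinAt f f' (Ici x) x :=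
  h.mono_of_mem_nhdsWithin (mem_of_superset (Icc_mem_nhdsGE hx.2) (Icc_subset_Icc_left hx.1))

lemma exists_beamSol {P : ℝ → ℝ} (hP : SymmetricWeight P) (lam : ℝ) (v : Fin 4 → ℝ) :
    ∃ s : ℝ → Fin 4 → ℝ, s 0 = v ∧ BeamSol P lam s := by
  set K : ℝ := 1 + 2 * |lam| with hK
  have hK0 : 0 ≤ K := by positivity
  set R : ℝ := ‖v‖ * Real.exp K with hR
  have hR0 : 0 ≤ R := by positivity
  have hPL : IsPicardLindelof (fun t w => beamField P lam t (truncate R w))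
      (tmin := 0) (tmax := 1) ⟨0, by simp⟩ v (K * R).toNNReal 0 (K * R).toNNReal K.toNNReal := by
    refine ⟨fun t ht => ?_, fun w _ => ?_, fun t ht w _ => ?_, ?_⟩
    · refine LipschitzWith.lipschitzOnWith (LipschitzWith.of_dist_le_mul fun w z => ?_)
      rw [dist_eq_norm, dist_eq_norm, ← beamField_sub, Real.coe_toNNReal _ hK0]
      exact (norm_beamField_le hP lam ht _).trans
        (mul_le_mul_of_nonneg_left (norm_truncate_sub_le R w z) hK0)
    · rw [continuousOn_pi]
      intro i
      have := hP.cont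
      fin_cases i <;> simp [beamField] <;> fun_prop
    · rw [Real.coe_toNNReal _ (by positivity)]
      exact (norm_beamField_le hP lam ht _).trans
        (mul_le_mul_of_nonneg_left (norm_truncate_le hR0 w) hK0)
    · simp
  obtain ⟨s, hs0, hs⟩ := hPL.exists_eq_forall_mem_Icc_hasDerivWithinAt₀
  have hs0 : s 0 = v := hs0
  refine ⟨s, hs0, ?_⟩
  have hbound : ∀ x ∈ Icc (0:ℝ) 1, ‖s x‖ ≤ R := by
    intro x hx
    have := norm_le_gronwallBound_of_norm_deriv_right_le (δ := ‖v‖) (K := K) (ε := 0)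
      (fun t ht => (hs t ht).continuousWithinAt)
      (fun t ht => hasDerivWithinAt_Ici_of_Icc ht (hs t ⟨ht.1, ht.2.le⟩))
      (by rw [hs0]) (fun t ht => by
        rw [add_zero]
        exact (norm_beamField_le hP lam ⟨ht.1, ht.2.le⟩ _).trans
          (mul_le_mul_of_nonneg_left (norm_truncate_le_norm hR0 (s t)) hK0)) x hx
    rw [gronwallBound_ε0] at this
    refine this.trans (mul_le_mul_of_nonneg_left (Real.exp_le_exp.2 ?_) (norm_nonneg v))
    nlinarith [hx.1, hx.2]
  intro x hx
  have := hs x hx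
  rwa [truncate_eq_self (hbound x hx)] at this

lemma BeamSol.continuousOn {P : ℝ → ℝ} {lam : ℝ} {s : ℝ → Fin 4 → ℝ} (hs : BeamSol P lam s) :
    ContinuousOn s (Icc 0 1) := fun x hx => (hs x hx).continuousWithinAt

lemma beamField_sub_lam (P : ℝ → ℝ) (lam mu x : ℝ) (v : Fin 4 → ℝ) {B : ℝ}
    (hp : |P x| ≤ 1) (hv : ‖v‖ ≤ B) :
    ‖beamField P mu x v - beamField P lam x v‖ ≤ |mu - lam| * (2 * B) := by
  have hB : 0 ≤ B := (norm_nonneg v).trans hv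
  have h0 : |v 0| ≤ B := (norm_le_pi_norm v 0).trans hv
  have h3 : |v 3| ≤ B := (norm_le_pi_norm v 3).trans hv
  have h : |P x * v 0 + v 3| ≤ 2 * B := by
    have h4 : |P x * v 0| ≤ 1 * B := by
      rw [abs_mul]
      exact mul_le_mul hp h0 (abs_nonneg _) zero_le_one
    linarith [abs_add_le (P x * v 0) (v 3)]
  rw [pi_norm_le_iff_of_nonneg (by positivity)]
  intro i
  fin_cases i
  · simp [beamField]; positivity
  · simp [beamField]; positivity
  · simp only [beamField, Fin.reduceFinMk, Pi.sub_apply, Matrix.cons_val, Real.norm_eq_abs,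
      ← sub_mul, abs_mul]
    exact mul_le_mul_of_nonneg_left h (abs_nonneg _)
  · simp [beamField]; positivity

/-- Solutions depend continuously on the parameter and on the initial data. -/
lemma BeamSol.exists_dist_le {P : ℝ → ℝ} (hP : SymmetricWeight P) {lam : ℝ}
    {s : ℝ → Fin 4 → ℝ} (hs : BeamSol P lam s) :
    ∃ C : ℝ, 0 ≤ C ∧ ∀ mu : ℝ, |mu - lam| ≤ 1 → ∀ r : ℝ → Fin 4 → ℝ, BeamSol P mu r →
      ∀ x ∈ Icc (0:ℝ) 1, ‖r x - s x‖ ≤ C * (‖r 0 - s 0‖ + |mu - lam|) := by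
  obtain ⟨B, hB⟩ := isCompact_Icc.exists_bound_of_continuousOn hs.continuousOn
  have hB0 : 0 ≤ B := (norm_nonneg _).trans (hB 0 (by simp))
  set K : ℝ := 1 + 2 * (|lam| + 1) with hK
  have hK0 : 0 < K := by positivity
  refine ⟨Real.exp K + 2 * B / K * (Real.exp K - 1), ?_, ?_⟩
  · have : 0 ≤ Real.exp K - 1 := by linarith [Real.add_one_le_exp K]
    positivity
  intro mu hmu r hr x hx
  have hmu' : |mu| ≤ |lam| + 1 := by
    have := abs_sub_abs_le_abs_sub mu lam
    linarith
  have hg := norm_le_gronwallBound_of_norm_deriv_right_le (f := fun t => r t - s t)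
    (f' := fun t => beamField P mu t (r t) - beamField P lam t (s t))
    (δ := ‖r 0 - s 0‖) (K := K) (ε := |mu - lam| * (2 * B)) (a := 0) (b := 1)
    (hr.continuousOn.sub hs.continuousOn)
    (fun t ht => (hasDerivWithinAt_Ici_of_Icc ht (hr t ⟨ht.1, ht.2.le⟩)).sub
      (hasDerivWithinAt_Ici_of_Icc ht (hs t ⟨ht.1, ht.2.le⟩)))
    le_rfl (fun t ht => by
      have ht' : t ∈ Icc (0:ℝ) 1 := ⟨ht.1, ht.2.le⟩
      have e : beamField P mu t (r t) - beamField P lam t (s t)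
          = beamField P mu t (r t - s t) + (beamField P mu t (s t) - beamField P lam t (s t)) := by
        rw [beamField_sub]; abel
      rw [e]
      refine (norm_add_le _ _).trans (add_le_add ?_ ?_)
      · refine (norm_beamField_le hP mu ht' _).trans
          (mul_le_mul_of_nonneg_right ?_ (norm_nonneg _))
        linarith
      · exact beamField_sub_lam P lam mu t (s t) (hP.abs_le_one ht') (hB t ht')) x hx
  refine hg.trans ?_
  rw [gronwallBound_of_K_ne_0 hK0.ne', sub_zero]
  have he : Real.exp (K * x) ≤ Real.exp K :=
    Real.exp_le_exp.2 (by nlinarith [hx.2])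
  have h1 : 0 ≤ Real.exp K - 1 := by linarith [Real.add_one_le_exp K]
  have hn := norm_nonneg (r 0 - s 0)
  have hm := abs_nonneg (mu - lam)
  calc ‖r 0 - s 0‖ * Real.exp (K * x) + |mu - lam| * (2 * B) / K * (Real.exp (K * x) - 1)
      ≤ ‖r 0 - s 0‖ * Real.exp K + |mu - lam| * (2 * B) / K * (Real.exp K - 1) := by gcongr
    _ ≤ ‖r 0 - s 0‖ * Real.exp K + |mu - lam| * (2 * B) / K * (Real.exp K - 1)
        + (|mu - lam| * Real.exp K + 2 * B / K * (Real.exp K - 1) * ‖r 0 - s 0‖) := by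
        have : 0 ≤ 2 * B / K * (Real.exp K - 1) := by positivity
        linarith [mul_nonneg hm (Real.exp_pos K).le, mul_nonneg this hn]
    _ = _ := by ring

lemma BeamSol.eqOn {P : ℝ → ℝ} (hP : SymmetricWeight P) {lam : ℝ} {r s : ℝ → Fin 4 → ℝ}
    (hr : BeamSol P lam r) (hs : BeamSol P lam s) (h0 : r 0 = s 0) :
    EqOn r s (Icc 0 1) := by
  intro x hx
  obtain ⟨C, -, hC⟩ := hs.exists_dist_le hP
  have := hC lam (by simp) r hr x hx
  rw [h0] at this
  simpa [sub_eq_zero] using this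

lemma BeamSol.smul {P : ℝ → ℝ} {lam : ℝ} {s : ℝ → Fin 4 → ℝ} (hs : BeamSol P lam s) (c : ℝ) :
    BeamSol P lam (fun x => c • s x) := by
  intro x hx
  have e : beamField P lam x (c • s x) = c • beamField P lam x (s x) := by
    ext i
    fin_cases i <;> simp [beamField] <;> ring
  rw [e]
  exact (hs x hx).const_smul c

lemma BeamSol.sub {P : ℝ → ℝ} {lam : ℝ} {r s : ℝ → Fin 4 → ℝ} (hr : BeamSol P lam r)
    (hs : BeamSol P lam s) : BeamSol P lam (fun x => r x - s x) := by
  intro x hx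
  rw [beamField_sub]
  exact (hr x hx).sub (hs x hx)

/-- If `h' = h1`, the increment over `[c, d]` of the Stieltjes integral of `h` against `dP`,
expressed by integration by parts through a primitive `G` of `-P h'`, is at least
`m (P d - P c)` as soon as `h ≥ m`. -/
lemma le_stieltjes_increment {P h h1 G G1 : ℝ → ℝ} {c d m C : ℝ} (hcd : c ≤ d)
    (hP : MonotoneOn P (Icc c d))
    (hh : ∀ x ∈ Icc c d, HasDerivWithinAt h (h1 x) (Icc c d) x)
    (hG : ∀ x ∈ Icc c d, HasDerivWithinAt G (G1 x) (Icc c d) x)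
    (hG1 : ∀ x ∈ Icc c d, -(P x * h1 x) ≤ G1 x)
    (hC : ∀ x ∈ Icc c d, |h1 x| ≤ C) (hm : ∀ x ∈ Icc c d, m ≤ h x) :
    m * (P d - P c) ≤ (P d * h d + G d) - (P c * h c + G c) := by
  have hC0 : 0 ≤ C := (abs_nonneg _).trans (hC c (left_mem_Icc.2 hcd))
  set J : ℝ → ℝ := fun x => P x * h x + G x - m * P x with hJ
  have step : ∀ x ∈ Icc c d, ∀ z ∈ Icc c d, x ≤ z →
      -(C * (z - x) * (P z - P x)) ≤ J z - J x := by
    intro x hx z hz hxz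
    have hsub : Icc x z ⊆ Icc c d := Icc_subset_Icc hx.1 hz.2
    have hPxz := hP hx hz hxz
    have hder : ∀ t ∈ Icc x z, HasDerivWithinAt
        (fun t => G t + P x * h t + C * (P z - P x) * t)
        (G1 t + P x * h1 t + C * (P z - P x) * 1) (Icc x z) t := fun t ht =>
      (((hG t (hsub ht)).mono hsub).add (((hh t (hsub ht)).mono hsub).const_mul (P x))).add
        ((hasDerivWithinAt_id t _).const_mul _)
    have hmono : MonotoneOn (fun t => G t + P x * h t + C * (P z - P x) * t) (Icc x z) := by
      refine monotoneOn_of_hasDerivWithinAt_nonneg (convex_Icc x z)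
        (fun t ht => (hder t ht).continuousWithinAt)
        (fun t ht => (hder t (interior_subset ht)).mono interior_subset) fun t ht => ?_
      have ht' := interior_subset ht
      have hG1t := hG1 t (hsub ht')
      have h2 := hP hx (hsub ht') ht'.1
      have h3 := hP (hsub ht') hz ht'.2
      have h4 : (P t - P x) * h1 t ≤ (P z - P x) * C := by
        calc (P t - P x) * h1 t ≤ (P t - P x) * C :=
              mul_le_mul_of_nonneg_left ((le_abs_self _).trans (hC t (hsub ht'))) (by linarith)
          _ ≤ _ := mul_le_mul_of_nonneg_right (by linarith) hC0
      nlinarith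
    have hinc := hmono (left_mem_Icc.2 hxz) (right_mem_Icc.2 hxz) hxz
    have hmz := hm z hz
    simp only [hJ] at hinc ⊢
    nlinarith [mul_nonneg (sub_nonneg.2 hmz) (sub_nonneg.2 hPxz)]
  have key : ∀ n : ℕ, -(C * (d - c) * (P d - P c) / (n + 1)) ≤ J d - J c := by
    intro n
    have hn : (0:ℝ) < n + 1 := by positivity
    set t : ℕ → ℝ := fun i => c + (d - c) * i / (n + 1) with ht
    have htm : ∀ i ≤ n + 1, t i ∈ Icc c d := by
      intro i hi
      have hi' : (i:ℝ) ≤ n + 1 := by exact_mod_cast hi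
      have h0 : 0 ≤ (d - c) * i / (n + 1) :=
        div_nonneg (mul_nonneg (sub_nonneg.2 hcd) (Nat.cast_nonneg i)) hn.le
      have h1 : (d - c) * i / (n + 1) ≤ d - c := by
        rw [div_le_iff₀ hn]
        exact mul_le_mul_of_nonneg_left hi' (sub_nonneg.2 hcd)
      exact ⟨by simp only [ht]; linarith, by simp only [ht]; linarith⟩
    have hts : ∀ i, t (i + 1) - t i = (d - c) / (n + 1) := by
      intro i
      simp only [ht]
      push_cast
      field_simp
      ring
    have ht0 : t 0 = c := by simp [ht]
    have htn : t (n + 1) = d := by simp only [ht]; push_cast; field_simp; ring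
    have hsum : ∑ i ∈ Finset.range (n + 1), -(C * ((d - c) / (n + 1)) * (P (t (i + 1)) - P (t i)))
        ≤ ∑ i ∈ Finset.range (n + 1), (J (t (i + 1)) - J (t i)) := by
      refine Finset.sum_le_sum fun i hi => ?_
      have hi' := Finset.mem_range.1 hi
      have h0 : 0 ≤ (d - c) / (n + 1) := div_nonneg (sub_nonneg.2 hcd) hn.le
      have := step (t i) (htm i (by omega)) (t (i + 1)) (htm (i + 1) (by omega))
        (by linarith [hts i])
      rwa [hts i] at this
    rw [Finset.sum_range_sub (fun i => J (t i)), Finset.sum_neg_distrib, ← Finset.mul_sum,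
      Finset.sum_range_sub (fun i => P (t i)), ht0, htn] at hsum
    have e : C * (d - c) * (P d - P c) / (n + 1) = C * ((d - c) / (n + 1)) * (P d - P c) := by
      ring
    rw [e]
    exact hsum
  have hlim : Tendsto (fun n : ℕ => -(C * (d - c) * (P d - P c) / ((n:ℝ) + 1))) atTop
      (nhds 0) := by
    have h1 : Tendsto (fun n : ℕ => (n:ℝ) + 1) atTop atTop :=
      tendsto_atTop_add_const_right _ _ tendsto_natCast_atTop_atTop
    simpa using (tendsto_const_nhds.div_atTop h1).neg
  have := le_of_tendsto' hlim key
  simp only [hJ] at this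
  linarith

/-- A function with nonnegative value and positive derivative to the right of a point is positive
there. -/
lemma pos_right_of_deriv_pos {f f1 : ℝ → ℝ} {c : ℝ} (hc : c ∈ Ico (0:ℝ) 1)
    (hf : ∀ x ∈ Icc (0:ℝ) 1, HasDerivWithinAt f (f1 x) (Icc 0 1) x) (h0 : 0 ≤ f c)
    (h : ∃ e ∈ Ioc c 1, ∀ x ∈ Ioo c e, 0 < f1 x) : ∃ e ∈ Ioc c 1, ∀ x ∈ Ioo c e, 0 < f x := by
  obtain ⟨e, he, hpos⟩ := h
  refine ⟨e, he, fun x hx => ?_⟩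
  have hsub : Icc c x ⊆ Icc (0:ℝ) 1 := Icc_subset_Icc hc.1 (hx.2.le.trans he.2)
  have hmono : StrictMonoOn f (Icc c x) := by
    refine strictMonoOn_of_hasDerivWithinAt_pos (f' := f1) (convex_Icc c x)
      (fun t ht => ((hf t (hsub ht)).mono hsub).continuousWithinAt)
      (fun t ht => ((hf t (hsub (interior_subset ht))).mono (interior_subset.trans hsub)))
      fun t ht => ?_
    rw [interior_Icc] at ht
    exact hpos t ⟨ht.1, ht.2.trans hx.2⟩
  exact h0.trans_lt (hmono (left_mem_Icc.2 hx.1.le) (right_mem_Icc.2 hx.1.le) hx.1)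

lemma pos_right_of_pos {f : ℝ → ℝ} {c : ℝ} (hc : c ∈ Ico (0:ℝ) 1)
    (hf : ContinuousOn f (Icc 0 1)) (h0 : 0 < f c) :
    ∃ e ∈ Ioc c 1, ∀ x ∈ Ioo c e, 0 < f x := by
  have h1 : ∀ᶠ x in nhdsWithin c (Ioi c), 0 < f x :=
    ((hf c ⟨hc.1, hc.2.le⟩).mono_of_mem_nhdsWithin
      (mem_of_superset (Icc_mem_nhdsGT hc.2) (Icc_subset_Icc_left hc.1))).eventually
      (lt_mem_nhds h0)
  obtain ⟨e, he, hsub⟩ := (mem_nhdsGT_iff_exists_Ioc_subset).1 h1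
  refine ⟨min e 1, ⟨lt_min he hc.2, min_le_right _ _⟩, fun x hx => hsub ⟨hx.1, ?_⟩⟩
  exact hx.2.le.trans (min_le_left _ _)

lemma monotoneOn_Icc_of_deriv_nonneg {f f1 : ℝ → ℝ} {c d : ℝ} (hc : 0 ≤ c) (hd : d ≤ 1)
    (hf : ∀ x ∈ Icc (0:ℝ) 1, HasDerivWithinAt f (f1 x) (Icc 0 1) x)
    (h : ∀ x ∈ Ioo c d, 0 ≤ f1 x) : MonotoneOn f (Icc c d) := by
  have hsub : Icc c d ⊆ Icc (0:ℝ) 1 := Icc_subset_Icc hc hd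
  refine monotoneOn_of_hasDerivWithinAt_nonneg (f' := f1) (convex_Icc c d)
    (fun t ht => ((hf t (hsub ht)).mono hsub).continuousWithinAt)
    (fun t ht => ((hf t (hsub (interior_subset ht))).mono (interior_subset.trans hsub)))
    fun t ht => ?_
  rw [interior_Icc] at ht
  exact h t ht

namespace BeamSol

variable {P : ℝ → ℝ} {lam : ℝ} {s : ℝ → Fin 4 → ℝ}

lemma hasDeriv_zero (hs : BeamSol P lam s) (x : ℝ) (hx : x ∈ Icc (0:ℝ) 1) :
    HasDerivWithinAt (fun t => s t 0) (s x 1) (Icc 0 1) x :=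
  hasDerivWithinAt_pi.1 (hs x hx) 0

lemma hasDeriv_one (hs : BeamSol P lam s) (x : ℝ) (hx : x ∈ Icc (0:ℝ) 1) :
    HasDerivWithinAt (fun t => s t 1) (s x 2) (Icc 0 1) x :=
  hasDerivWithinAt_pi.1 (hs x hx) 1

lemma hasDeriv_two (hs : BeamSol P lam s) (x : ℝ) (hx : x ∈ Icc (0:ℝ) 1) :
    HasDerivWithinAt (fun t => s t 2) (lam * shear P s x) (Icc 0 1) x :=
  hasDerivWithinAt_pi.1 (hs x hx) 2

lemma hasDeriv_three (hs : BeamSol P lam s) (x : ℝ) (hx : x ∈ Icc (0:ℝ) 1) :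
    HasDerivWithinAt (fun t => s t 3) (-(P x * s x 1)) (Icc 0 1) x :=
  hasDerivWithinAt_pi.1 (hs x hx) 3

lemma continuousOn_apply (hs : BeamSol P lam s) (i : Fin 4) :
    ContinuousOn (fun t => s t i) (Icc 0 1) := continuousOn_pi.1 hs.continuousOn i

lemma continuousOn_shear (hP : SymmetricWeight P) (hs : BeamSol P lam s) :
    ContinuousOn (shear P s) (Icc 0 1) :=
  (hP.cont.mul (hs.continuousOn_apply 0)).add (hs.continuousOn_apply 3)

lemma le_shear_sub (hP : SymmetricWeight P) (hs : BeamSol P lam s) {c d m : ℝ} (hc : 0 ≤ c)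
    (hcd : c ≤ d) (hd : d ≤ 1) (hm : ∀ x ∈ Icc c d, m ≤ s x 0) :
    m * (P d - P c) ≤ shear P s d - shear P s c := by
  have hsub : Icc c d ⊆ Icc (0:ℝ) 1 := Icc_subset_Icc hc hd
  obtain ⟨C, hC⟩ := isCompact_Icc.exists_bound_of_continuousOn (hs.continuousOn_apply 1)
  exact le_stieltjes_increment hcd (hP.mono.mono hsub)
    (fun x hx => (hs.hasDeriv_zero x (hsub hx)).mono hsub)
    (fun x hx => (hs.hasDeriv_three x (hsub hx)).mono hsub) (fun x _ => le_rfl)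
    (fun x hx => hC x (hsub hx)) hm

lemma shear_mono (hP : SymmetricWeight P) (hs : BeamSol P lam s) {c d : ℝ} (hc : 0 ≤ c)
    (hd : d ≤ 1) (hm : ∀ x ∈ Ioo c d, 0 ≤ s x 0) : MonotoneOn (shear P s) (Icc c d) := by
  intro x hx z hz hxz
  rcases hxz.eq_or_lt with rfl | hlt
  · exact le_rfl
  have hsub : Icc x z ⊆ Icc (0:ℝ) 1 := Icc_subset_Icc (hc.trans hx.1) (hz.2.trans hd)
  have hcl : Icc x z ⊆ {t | t ∈ Icc x z ∧ 0 ≤ s t 0} := by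
    have hclosed : IsClosed {t | t ∈ Icc x z ∧ 0 ≤ s t 0} :=
      ((hs.continuousOn_apply 0).mono hsub).preimage_isClosed_of_isClosed isClosed_Icc
        isClosed_Ici
    conv_lhs => rw [← closure_Ioo hlt.ne]
    exact closure_minimal (fun t ht => ⟨Ioo_subset_Icc_self ht,
      hm t ⟨hx.1.trans_lt ht.1, ht.2.trans_le hz.2⟩⟩) hclosed
  have := hs.le_shear_sub hP (hc.trans hx.1) hxz (hz.2.trans hd) (m := 0)
    fun t ht => (hcl ht).2
  linarith

/-- Nonnegative data at a point propagate to the right. -/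
lemma pos_forward (hP : SymmetricWeight P) (hlam : 0 ≤ lam) (hs : BeamSol P lam s) {c : ℝ}
    (hc : c ∈ Ico (0:ℝ) 1) (h0 : 0 ≤ s c 0) (h1 : 0 ≤ s c 1) (h2 : 0 ≤ s c 2)
    (h3 : 0 ≤ shear P s c)
    (h : 0 < s c 0 ∨ 0 < s c 1 ∨ 0 < s c 2 ∨ 0 < lam * shear P s c) :
    0 < shear P s 1 ∧ ∀ x ∈ Ioc c 1, 0 < s x 0 := by
  have hnear : ∃ e ∈ Ioc c 1, ∀ x ∈ Ioo c e, 0 < s x 0 := by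
    rcases h with h | h | h | h
    · exact pos_right_of_pos hc (hs.continuousOn_apply 0) h
    · exact pos_right_of_deriv_pos hc hs.hasDeriv_zero h0
        (pos_right_of_pos hc (hs.continuousOn_apply 1) h)
    · exact pos_right_of_deriv_pos hc hs.hasDeriv_zero h0 <|
        pos_right_of_deriv_pos hc hs.hasDeriv_one h1
        (pos_right_of_pos hc (hs.continuousOn_apply 2) h)
    · exact pos_right_of_deriv_pos hc hs.hasDeriv_zero h0 <|
        pos_right_of_deriv_pos hc hs.hasDeriv_one h1 <|
        pos_right_of_deriv_pos hc hs.hasDeriv_two h2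
        (pos_right_of_pos hc ((hs.continuousOn_shear hP).const_smul lam) h)
  obtain ⟨e, he, hpos⟩ := hnear
  have hmono : ∀ d ≤ 1, (∀ x ∈ Ioo c d, 0 < s x 0) → MonotoneOn (fun x => s x 0) (Icc c d) := by
    intro d hd hp
    have m3 := hs.shear_mono hP hc.1 hd fun x hx => (hp x hx).le
    have m2 := monotoneOn_Icc_of_deriv_nonneg hc.1 hd hs.hasDeriv_two fun x hx =>
      mul_nonneg hlam (h3.trans (m3 ⟨le_rfl, (hx.1.trans hx.2).le⟩ (Ioo_subset_Icc_self hx) hx.1.le))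
    have m1 := monotoneOn_Icc_of_deriv_nonneg hc.1 hd hs.hasDeriv_one fun x hx =>
      h2.trans (m2 ⟨le_rfl, (hx.1.trans hx.2).le⟩ (Ioo_subset_Icc_self hx) hx.1.le)
    exact monotoneOn_Icc_of_deriv_nonneg hc.1 hd hs.hasDeriv_zero fun x hx =>
      h1.trans (m1 ⟨le_rfl, (hx.1.trans hx.2).le⟩ (Ioo_subset_Icc_self hx) hx.1.le)
  set p := (c + e) / 2 with hp
  have hpc : p ∈ Ioo c e := ⟨by linarith [he.1], by linarith [he.1]⟩
  have hall : ∀ x ∈ Ioc c 1, 0 < s x 0 := by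
    by_contra! hcon
    obtain ⟨z, hz, hz0⟩ := hcon
    have hze : e ≤ z := by
      by_contra! hlt
      exact (hpos z ⟨hz.1, hlt⟩).not_ge hz0
    set S : Set ℝ := {x | x ∈ Icc e 1 ∧ s x 0 ≤ 0} with hS
    have hsub : Icc e 1 ⊆ Icc (0:ℝ) 1 := Icc_subset_Icc_left (hc.1.trans he.1.le)
    have hScl : IsClosed S := ((hs.continuousOn_apply 0).mono hsub).preimage_isClosed_of_isClosed
      isClosed_Icc isClosed_Iic
    have hSc : IsCompact S := isCompact_Icc.of_isClosed_subset hScl fun x hx => hx.1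
    obtain ⟨q, hqS, hq⟩ := hSc.exists_isLeast ⟨z, ⟨hze, hz.2⟩, hz0⟩
    have hlt : ∀ x ∈ Ioo c q, 0 < s x 0 := by
      intro x hx
      by_contra! hcon
      rcases lt_or_ge x e with hxe | hxe
      · exact (hpos x ⟨hx.1, hxe⟩).not_ge hcon
      · exact (hq ⟨⟨hxe, hx.2.le.trans hqS.1.2⟩, hcon⟩).not_gt hx.2
    have hpq : p < q := hpc.2.trans_le hqS.1.1
    have := hmono q hqS.1.2 hlt ⟨hpc.1.le, hpq.le⟩ ⟨(hpc.1.trans hpq).le, le_rfl⟩ hpq.le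
    exact ((hpos p hpc).trans_le this).not_ge hqS.2
  refine ⟨?_, hall⟩
  have hp1 : p < 1 := hpc.2.trans_le he.2
  have hp0 : 0 ≤ p := hc.1.trans hpc.1.le
  have m0 := hmono 1 le_rfl fun x hx => hall x (Ioo_subset_Ioc_self hx)
  have m3 := hs.shear_mono hP hc.1 le_rfl fun x hx => (hall x (Ioo_subset_Ioc_self hx)).le
  have hinc := hs.le_shear_sub hP hp0 hp1.le le_rfl (m := s p 0) fun x hx =>
    m0 ⟨hpc.1.le, hp1.le⟩ ⟨hpc.1.le.trans hx.1, hx.2⟩ hx.1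
  have h4 : shear P s c ≤ shear P s p := m3 ⟨le_rfl, hc.2.le⟩ ⟨hpc.1.le, hp1.le⟩ hpc.1.le
  have h5 : 0 < s p 0 * (P 1 - P p) := by
    rw [hP.one]
    exact mul_pos (hpos p hpc) (sub_pos.2 (hP.lt_one ⟨hp0, hp1⟩))
  linarith

end BeamSol

/-- The reflection `x ↦ 1 - x` of a solution. -/
def reflectSol (s : ℝ → Fin 4 → ℝ) (x : ℝ) : Fin 4 → ℝ :=
  ![s (1 - x) 0, -s (1 - x) 1, s (1 - x) 2, -s (1 - x) 3 - s (1 - x) 0]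

lemma shear_reflectSol {P : ℝ → ℝ} (hP : SymmetricWeight P) (s : ℝ → Fin 4 → ℝ) {x : ℝ}
    (hx : x ∈ Icc (0:ℝ) 1) : shear P (reflectSol s) x = -shear P s (1 - x) := by
  simp [shear, reflectSol, hP.symm x hx]
  ring

lemma BeamSol.reflect {P : ℝ → ℝ} (hP : SymmetricWeight P) {lam : ℝ} {s : ℝ → Fin 4 → ℝ}
    (hs : BeamSol P lam s) : BeamSol P lam (reflectSol s) := by
  intro x hx
  have hx' : 1 - x ∈ Icc (0:ℝ) 1 := ⟨by linarith [hx.2], by linarith [hx.1]⟩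
  have hmaps : MapsTo (fun t : ℝ => 1 - t) (Icc 0 1) (Icc 0 1) :=
    fun t ht => ⟨by linarith [ht.2], by linarith [ht.1]⟩
  have hd : HasDerivWithinAt (fun t : ℝ => 1 - t) (-1) (Icc 0 1) x := by
    simpa using (hasDerivWithinAt_id x (Icc (0:ℝ) 1)).const_sub 1
  have key : ∀ f : ℝ → ℝ, ∀ f' : ℝ, HasDerivWithinAt f f' (Icc 0 1) (1 - x) →
      HasDerivWithinAt (fun t => f (1 - t)) (-f') (Icc 0 1) x := by
    intro f f' hf
    have := HasDerivWithinAt.comp x hf hd hmaps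
    simpa [Function.comp_def] using this
  have d0 := key _ _ (hs.hasDeriv_zero _ hx')
  have d1 := key _ _ (hs.hasDeriv_one _ hx')
  have d2 := key _ _ (hs.hasDeriv_two _ hx')
  have d3 := key _ _ (hs.hasDeriv_three _ hx')
  rw [hasDerivWithinAt_pi]
  intro i
  fin_cases i
  · exact d0
  · have := d1.neg
    rw [neg_neg] at this
    exact this
  · have e : -(lam * shear P s (1 - x)) = beamField P lam x (reflectSol s x) 2 := by
      rw [← mul_neg, ← shear_reflectSol hP s hx]
      rfl
    rw [e] at d2
    exact d2
  · have := d3.neg.sub d0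
    have e : -(- -(P (1 - x) * s (1 - x) 1)) - -s (1 - x) 1
        = beamField P lam x (reflectSol s x) 3 := by
      simp [beamField, reflectSol, hP.symm x hx]
      ring
    rw [e] at this
    exact this

/-- Data that are nonnegative after reflection propagate to the left. -/
lemma BeamSol.pos_backward {P : ℝ → ℝ} (hP : SymmetricWeight P) {lam : ℝ} (hlam : 0 ≤ lam)
    {s : ℝ → Fin 4 → ℝ} (hs : BeamSol P lam s) {c : ℝ} (hc : c ∈ Ioc (0:ℝ) 1)
    (h0 : 0 ≤ s c 0) (h1 : s c 1 ≤ 0) (h2 : 0 ≤ s c 2) (h3 : shear P s c ≤ 0)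
    (h : 0 < s c 0 ∨ s c 1 < 0 ∨ 0 < s c 2 ∨ lam * shear P s c < 0) :
    shear P s 0 < 0 := by
  have hc' : 1 - c ∈ Icc (0:ℝ) 1 := ⟨by linarith [hc.2], by linarith [hc.1]⟩
  have e := shear_reflectSol hP s hc'
  rw [sub_sub_cancel] at e
  have := ((hs.reflect hP).pos_forward hP hlam (c := 1 - c)
    ⟨by linarith [hc.2], by linarith [hc.1]⟩ (by simpa [reflectSol]) (by simpa [reflectSol])
    (by simpa [reflectSol]) (by rw [e]; linarith)
    (by rw [e, mul_neg]; simpa [reflectSol] using h)).1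
  rw [shear_reflectSol hP s (by simp), sub_self] at this
  linarith

/-! ### Stability of the number of zeros -/

/-- The number of zeros of `f` in `[u, v)`. -/
noncomputable def zeroCount (f : ℝ → ℝ) (u v : ℝ) : ℕ∞ := {t ∈ Ico u v | f t = 0}.encard

lemma zeroCount_add (f : ℝ → ℝ) {u v w : ℝ} (huv : u ≤ v) (hvw : v ≤ w) :
    zeroCount f u w = zeroCount f u v + zeroCount f v w := by
  rw [zeroCount, zeroCount, zeroCount, ← encard_union_eq]
  · congr 1
    ext t
    simp only [mem_ofPred_eq, mem_union, ← or_and_right]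
    rw [← mem_union, Ico_union_Ico_eq_Ico huv hvw]
  · rw [Set.disjoint_left]
    rintro t ⟨ht, -⟩ ⟨ht', -⟩
    exact absurd ht.2 (not_lt.2 ht'.1)

lemma zeroCount_eq_zero {f : ℝ → ℝ} {u v : ℝ} (h : ∀ t ∈ Ico u v, f t ≠ 0) :
    zeroCount f u v = 0 := by
  rw [zeroCount, encard_eq_zero, eq_empty_iff_forall_notMem]
  exact fun t ht => h t ht.1 ht.2

lemma zeroCount_neg (f : ℝ → ℝ) (u v : ℝ) : zeroCount (fun t => -f t) u v = zeroCount f u v := by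
  simp [zeroCount]

lemma zeroCount_congr {f g : ℝ → ℝ} {u v : ℝ} (h : ∀ t ∈ Ico u v, f t = 0 ↔ g t = 0) :
    zeroCount f u v = zeroCount g u v := by
  rw [zeroCount, zeroCount]
  congr 1
  ext t
  exact and_congr_right fun ht => h t ht

open Classical in
lemma zeroCount_of_strictMonoOn {g : ℝ → ℝ} {u v : ℝ} (huv : u < v)
    (hc : ContinuousOn g (Icc u v)) (hg : StrictMonoOn g (Icc u v)) :
    zeroCount g u v = if g u ≤ 0 ∧ 0 < g v then 1 else 0 := by
  have hu : u ∈ Icc u v := left_mem_Icc.2 huv.le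
  have hv : v ∈ Icc u v := right_mem_Icc.2 huv.le
  split_ifs with h
  · obtain ⟨t, ht, ht0⟩ := intermediate_value_Icc huv.le hc ⟨h.1, h.2.le⟩
    have htv : t < v := lt_of_le_of_ne ht.2 fun e => by rw [e] at ht0; linarith
    rw [zeroCount, encard_eq_one]
    refine ⟨t, ?_⟩
    ext z
    constructor
    · rintro ⟨hz, hz0⟩
      exact hg.injOn (Ico_subset_Icc_self hz) ht (hz0.trans ht0.symm)
    · rintro rfl
      exact ⟨⟨ht.1, htv⟩, ht0⟩
  · refine zeroCount_eq_zero fun t ht h0 => h ⟨?_, ?_⟩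
    · rw [← h0]
      exact hg.monotoneOn hu (Ico_subset_Icc_self ht) ht.1
    · rw [← h0]
      exact hg (Ico_subset_Icc_self ht) hv ht.2

open Classical in
/-- The correction, `0` or `1`, recording whether the perturbation `g` of `f` has moved the zero
`x` of `f` to the left. -/
noncomputable def zeroShift (f f1 g : ℝ → ℝ) (x : ℝ) : ℕ∞ :=
  if f x = 0 ∧ 0 < g x * f1 x then 1 else 0

lemma zeroShift_of_ne {f f1 g : ℝ → ℝ} {x : ℝ} (h : f x ≠ 0) : zeroShift f f1 g x = 0 := by
  simp [zeroShift, h]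

/-- The zeros of `C¹`-small perturbations of `f` in `[u, v)` are counted by the zeros of `f`, up to
the corrections at the end points. -/
def StableZeros (f f1 : ℝ → ℝ) (u v : ℝ) : Prop :=
  zeroCount f u v < ⊤ ∧ ∃ ε > 0, ∀ g g1 : ℝ → ℝ,
    (∀ x ∈ Icc (0:ℝ) 1, HasDerivWithinAt g (g1 x) (Icc 0 1) x) →
    (∀ x ∈ Icc (0:ℝ) 1, |g x - f x| < ε ∧ |g1 x - f1 x| < ε) →
    zeroCount g u v + zeroShift f f1 g u = zeroCount f u v + zeroShift f f1 g v

namespace StableZeros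

variable {f f1 : ℝ → ℝ}

lemma refl (f f1 : ℝ → ℝ) (u : ℝ) : StableZeros f f1 u u :=
  ⟨by simp [zeroCount], 1, one_pos, fun g g1 _ _ => by simp [zeroCount]⟩

lemma trans {u v w : ℝ} (huv : u ≤ v) (hvw : v ≤ w) (h : StableZeros f f1 u v)
    (h' : StableZeros f f1 v w) : StableZeros f f1 u w := by
  obtain ⟨hf, ε, hε, h⟩ := h
  obtain ⟨hf', ε', hε', h'⟩ := h'
  refine ⟨by rw [zeroCount_add f huv hvw]; exact WithTop.add_lt_top.2 ⟨hf, hf'⟩,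
    min ε ε', lt_min hε hε', fun g g1 hg hc => ?_⟩
  have e := h g g1 hg fun x hx =>
    ⟨(hc x hx).1.trans_le (min_le_left _ _), (hc x hx).2.trans_le (min_le_left _ _)⟩
  have e' := h' g g1 hg fun x hx =>
    ⟨(hc x hx).1.trans_le (min_le_right _ _), (hc x hx).2.trans_le (min_le_right _ _)⟩
  rw [zeroCount_add f huv hvw, zeroCount_add g huv hvw, add_right_comm, e, add_right_comm,
    add_assoc, e', add_assoc]

lemma of_neg {u v : ℝ} (h : StableZeros (fun t => -f t) (fun t => -f1 t) u v) :
    StableZeros f f1 u v := by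
  obtain ⟨hf, ε, hε, h⟩ := h
  rw [zeroCount_neg] at hf h
  refine ⟨hf, ε, hε, fun g g1 hg hc => ?_⟩
  have e := h (fun t => -g t) (fun t => -g1 t) (fun x hx => (hg x hx).neg) fun x hx => by
    have := hc x hx
    rw [← abs_neg (g x - f x), ← abs_neg (g1 x - f1 x)] at this
    convert this using 3 <;> ring
  rw [zeroCount_neg] at e
  simpa [zeroShift] using e

lemma strictMonoOn_of_pos {g g1 : ℝ → ℝ} {u v : ℝ} (hu : 0 ≤ u) (hv : v ≤ 1)
    (hg : ∀ x ∈ Icc (0:ℝ) 1, HasDerivWithinAt g (g1 x) (Icc 0 1) x)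
    (h : ∀ x ∈ Icc u v, 0 < g1 x) : StrictMonoOn g (Icc u v) := by
  have hsub : Icc u v ⊆ Icc 0 1 := Icc_subset_Icc hu hv
  refine strictMonoOn_of_hasDerivWithinAt_pos (convex_Icc u v)
    (fun x hx => (hg x (hsub hx)).continuousWithinAt.mono hsub)
    (fun x hx => (hg x (hsub (interior_subset hx))).mono (interior_subset.trans hsub))
    fun x hx => h x (interior_subset hx)

lemma of_deriv_pos {c u v : ℝ} (hc : 0 < c) (hu : 0 ≤ u) (hv : v ≤ 1) (huv : u ≤ v)
    (hf : ∀ x ∈ Icc (0:ℝ) 1, HasDerivWithinAt f (f1 x) (Icc 0 1) x)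
    (h : ∀ x ∈ Icc u v, c < f1 x) : StableZeros f f1 u v := by
  classical
  obtain rfl | huv := huv.eq_or_lt
  · exact refl f f1 u
  have hsub : Icc u v ⊆ Icc 0 1 := Icc_subset_Icc hu hv
  have hum : u ∈ Icc u v := left_mem_Icc.2 huv.le
  have hvm : v ∈ Icc u v := right_mem_Icc.2 huv.le
  have hfm := strictMonoOn_of_pos hu hv hf fun x hx => hc.trans (h x hx)
  have hfc : ContinuousOn f (Icc u v) :=
    fun x hx => (hf x (hsub hx)).continuousWithinAt.mono hsub
  have hpos : ∀ z : ℝ, ∃ ε > 0, ∀ r, |r - z| < ε → (0 < z → 0 < r) ∧ (z < 0 → r < 0) := by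
    intro z
    obtain hz | hz := eq_or_ne z 0
    · exact ⟨1, one_pos, fun r _ => ⟨fun h => absurd hz h.ne', fun h => absurd hz h.ne⟩⟩
    · refine ⟨|z|, abs_pos.2 hz, fun r hr => ⟨fun h => ?_, fun h => ?_⟩⟩
      · rw [abs_of_pos h, abs_lt] at hr; linarith
      · rw [abs_of_neg h, abs_lt] at hr; linarith
  obtain ⟨ε₁, hε₁, H₁⟩ := hpos (f u)
  obtain ⟨ε₂, hε₂, H₂⟩ := hpos (f v)
  refine ⟨?_, min c (min ε₁ ε₂), by positivity, fun g g1 hg hcl => ?_⟩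
  · rw [zeroCount_of_strictMonoOn huv hfc hfm]
    split_ifs <;> simp
  have hg1 : ∀ x ∈ Icc u v, 0 < g1 x := fun x hx => by
    have h1 := (abs_lt.1 ((hcl x (hsub hx)).2.trans_le (min_le_left _ _))).1
    have h2 := h x hx
    linarith
  have hgm := strictMonoOn_of_pos hu hv hg hg1
  have hgc : ContinuousOn g (Icc u v) :=
    fun x hx => (hg x (hsub hx)).continuousWithinAt.mono hsub
  rw [zeroCount_of_strictMonoOn huv hfc hfm, zeroCount_of_strictMonoOn huv hgc hgm]
  have hu1 := H₁ (g u) ((hcl u (hsub hum)).1.trans_le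
    ((min_le_right _ _).trans (min_le_left _ _)))
  have hv1 := H₂ (g v) ((hcl v (hsub hvm)).1.trans_le
    ((min_le_right _ _).trans (min_le_right _ _)))
  have hf1u := hc.trans (h u hum)
  have hf1v := hc.trans (h v hvm)
  have hlf := hfm hum hvm huv
  have hlg := hgm hum hvm huv
  simp only [zeroShift, mul_pos_iff_of_pos_right hf1u, mul_pos_iff_of_pos_right hf1v]
  rcases lt_trichotomy (f u) 0 with hfu | hfu | hfu
  · have := hu1.2 hfu
    rcases lt_trichotomy (f v) 0 with hfv | hfv | hfv
    · have := hv1.2 hfv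
      simp [hfu.ne, hfv.ne, not_lt.2 this.le, not_lt.2 hfv.le]
    · simp [hfu.ne, hfv, this.le]
    · have h3 := hv1.1 hfv
      simp [hfu.ne, hfv.ne', this.le, hfu.le, h3, hfv]
  · have hfv : 0 < f v := hfu ▸ hlf
    have h3 := hv1.1 hfv
    simp only [hfu, h3, hfv, hfv.ne', and_true, true_and, le_refl, if_true, if_false,
      add_zero]
    split_ifs <;> first | rfl | (exfalso; linarith)
  · have h3 := hu1.1 hfu
    have hfv : 0 < f v := hfu.trans hlf
    simp [hfu.ne', hfv.ne', not_le.2 h3, not_le.2 hfu]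

lemma exists_nhds (hf : ∀ x ∈ Icc (0:ℝ) 1, HasDerivWithinAt f (f1 x) (Icc 0 1) x)
    (hf1 : ContinuousOn f1 (Icc 0 1)) {x : ℝ} (hx : x ∈ Icc (0:ℝ) 1)
    (h : f x ≠ 0 ∨ f1 x ≠ 0) :
    ∃ δ > 0, ∀ u v, 0 ≤ u → u ≤ v → v ≤ 1 → Icc u v ⊆ Metric.ball x δ → StableZeros f f1 u v := by
  have hnear : ∀ {k : ℝ → ℝ}, ContinuousOn k (Icc 0 1) → ∀ c > 0,
      ∃ δ > 0, ∀ t ∈ Icc (0:ℝ) 1, t ∈ Metric.ball x δ → |k t - k x| < c := by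
    intro k hk c hc
    obtain ⟨δ, hδ, H⟩ := Metric.continuousOn_iff.1 hk x hx c hc
    exact ⟨δ, hδ, fun t ht htx => H t ht htx⟩
  by_cases hfx : f x = 0
  · have hf1x : f1 x ≠ 0 := h.resolve_left (fun h => h hfx)
    obtain ⟨δ, hδ, H⟩ := hnear hf1 (|f1 x| / 2) (by positivity)
    refine ⟨δ, hδ, fun u v hu huv hv hb => ?_⟩
    have H' : ∀ t ∈ Icc u v, |f1 t - f1 x| < |f1 x| / 2 := fun t ht =>
      H t (Icc_subset_Icc hu hv ht) (hb ht)
    rcases lt_or_gt_of_ne hf1x with h0 | h0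
    · refine of_neg (of_deriv_pos (c := |f1 x| / 2) (by positivity) hu hv huv
        (fun t ht => (hf t ht).neg) fun t ht => ?_)
      have := abs_lt.1 (H' t ht)
      rw [abs_of_neg h0] at this ⊢
      linarith
    · refine of_deriv_pos (c := |f1 x| / 2) (by positivity) hu hv huv hf fun t ht => ?_
      have := abs_lt.1 (H' t ht)
      rw [abs_of_pos h0] at this ⊢
      linarith
  · obtain ⟨δ, hδ, H⟩ := hnear (fun t ht => (hf t ht).continuousWithinAt) (|f x| / 2)
      (by positivity)
    refine ⟨δ, hδ, fun u v hu huv hv hb => ?_⟩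
    have hne : ∀ r : ℝ, ∀ t ∈ Icc u v, |r - f t| < |f x| / 2 → r ≠ 0 := by
      rintro r t ht hr rfl
      have h1 := H t (Icc_subset_Icc hu hv ht) (hb ht)
      have h2 := abs_sub_abs_le_abs_sub (f x) (f t)
      rw [zero_sub, abs_neg] at hr
      rw [abs_sub_comm] at h2
      linarith
    have hfne : ∀ t ∈ Icc u v, f t ≠ 0 := fun t ht =>
      hne _ t ht (by rw [sub_self, abs_zero]; positivity)
    have hf0 : zeroCount f u v = 0 :=
      zeroCount_eq_zero fun t ht => hfne t (Ico_subset_Icc_self ht)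
    refine ⟨by simp [hf0], |f x| / 2, by positivity, fun g g1 hg hcl => ?_⟩
    rw [hf0, zeroShift_of_ne (hfne u (left_mem_Icc.2 huv)),
      zeroShift_of_ne (hfne v (right_mem_Icc.2 huv)), zeroCount_eq_zero fun t ht =>
        hne _ t (Ico_subset_Icc_self ht)
          (hcl t (Icc_subset_Icc hu hv (Ico_subset_Icc_self ht))).1]

/-- A `C¹` function without double zeros has a stable number of zeros. -/
lemma of_forall_ne (hf : ∀ x ∈ Icc (0:ℝ) 1, HasDerivWithinAt f (f1 x) (Icc 0 1) x)
    (hf1 : ContinuousOn f1 (Icc 0 1)) (h : ∀ x ∈ Icc (0:ℝ) 1, f x ≠ 0 ∨ f1 x ≠ 0) :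
    StableZeros f f1 0 1 := by
  choose! δ hδ H using fun x (hx : x ∈ Icc (0:ℝ) 1) => exists_nhds hf hf1 hx (h x hx)
  obtain ⟨t, ht0, htm, ⟨n, hn⟩, ht⟩ := exists_monotone_Icc_subset_open_cover_Icc
    (a := (0:ℝ)) (b := 1) zero_le_one
    (c := fun i : Icc (0:ℝ) 1 => Metric.ball i (δ i)) (fun _ => Metric.isOpen_ball)
    (fun x _ => mem_iUnion.2 ⟨x, Metric.mem_ball_self (hδ x x.2)⟩)
  have key : ∀ m, StableZeros f f1 0 (t m) := by
    intro m
    induction m with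
    | zero => rw [ht0]; exact refl f f1 0
    | succ m ih =>
      have hle : (t m : ℝ) ≤ t (m + 1) := htm (Nat.le_succ m)
      obtain ⟨i, hi⟩ := ht m
      refine ih.trans (t m).2.1 hle (H i i.2 _ _ (t m).2.1 hle (t (m + 1)).2.2 fun z hz => ?_)
      exact hi (a := ⟨z, (t m).2.1.trans hz.1, hz.2.trans (t (m + 1)).2.2⟩) hz
  have := key n
  rwa [hn n le_rfl] at this

end StableZeros

/-! ### Solutions with vanishing third derivative at the end points -/

lemma BeamSol.apply_zero_eq_zero {P : ℝ → ℝ} (hP : SymmetricWeight P) {lam : ℝ}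
    {s : ℝ → Fin 4 → ℝ} (hs : BeamSol P lam s) {c : ℝ} (hc : c ∈ Icc (0:ℝ) 1) (h : s c = 0) :
    s 0 = 0 := by
  have hsub : Icc 0 c ⊆ Icc (0:ℝ) 1 := Icc_subset_Icc_right hc.2
  have h0 : ∀ x, beamField P lam x 0 = 0 := fun x => by simpa using beamField_sub P lam x 0 0
  refine ODE_solution_unique_of_mem_Icc_left (v := beamField P lam) (g := fun _ => 0)
    (s := fun _ => univ) (K := (1 + 2 * |lam|).toNNReal)
    (fun t ht => ?_) (hs.continuousOn.mono hsub) (fun t ht => ?_) (fun _ _ => mem_univ _)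
    continuousOn_const (fun t _ => ?_) (fun _ _ => mem_univ _) h (left_mem_Icc.2 hc.1)
  · refine LipschitzOnWith.of_dist_le_mul fun v _ w _ => ?_
    rw [dist_eq_norm, dist_eq_norm, ← beamField_sub, Real.coe_toNNReal _ (by positivity)]
    exact norm_beamField_le hP lam (hsub (Ioc_subset_Icc_self ht)) _
  · have ht' : t ∈ Ioc (0:ℝ) 1 := ⟨ht.1, ht.2.trans hc.2⟩
    exact (hs t (Ioc_subset_Icc_self ht')).mono_of_mem_nhdsWithin
      (mem_of_superset (Ioc_mem_nhdsLE ht.1)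
        ((Ioc_subset_Ioc_right ht'.2).trans Ioc_subset_Icc_self))
  · rw [h0]
    exact hasDerivWithinAt_const _ _ _

/-- Nontrivial solutions whose third derivative vanishes at both end points. -/
structure FreeSol (P : ℝ → ℝ) (lam : ℝ) (s : ℝ → Fin 4 → ℝ) : Prop where
  sol : BeamSol P lam s
  ne : s 0 ≠ 0
  shear_zero : shear P s 0 = 0
  shear_one : shear P s 1 = 0

namespace FreeSol

variable {P : ℝ → ℝ} {lam : ℝ} {s : ℝ → Fin 4 → ℝ}

lemma smul (hs : FreeSol P lam s) {c : ℝ} (hc : c ≠ 0) : FreeSol P lam (fun x => c • s x) where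
  sol := hs.sol.smul c
  ne := smul_ne_zero hc hs.ne
  shear_zero := by
    have := hs.shear_zero
    simp only [shear, Pi.smul_apply, smul_eq_mul] at this ⊢
    linear_combination c * this
  shear_one := by
    have := hs.shear_one
    simp only [shear, Pi.smul_apply, smul_eq_mul] at this ⊢
    linear_combination c * this

lemma neg (hs : FreeSol P lam s) : FreeSol P lam (fun x => -s x) := by
  simpa using hs.smul (c := -1) (by norm_num)

lemma apply_ne_zero (hP : SymmetricWeight P) (hs : FreeSol P lam s) {c : ℝ}
    (hc : c ∈ Icc (0:ℝ) 1) : s c ≠ 0 := fun h => hs.ne (hs.sol.apply_zero_eq_zero hP hc h)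

lemma reflect (hP : SymmetricWeight P) (hs : FreeSol P lam s) : FreeSol P lam (reflectSol s) where
  sol := hs.sol.reflect hP
  ne := fun h => by
    refine hs.apply_ne_zero hP (c := 1) (by simp) ?_
    have h0 := congrFun h 0
    have h1 := congrFun h 1
    have h2 := congrFun h 2
    have h3 := congrFun h 3
    simp [reflectSol] at h0 h1 h2 h3
    rw [h0, sub_zero, neg_eq_zero] at h3
    ext i
    fin_cases i <;> assumption
  shear_zero := by rw [shear_reflectSol hP s (by simp), sub_zero, hs.shear_one, neg_zero]
  shear_one := by rw [shear_reflectSol hP s (by simp), sub_self, hs.shear_zero, neg_zero]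

lemma not_both_zero_of_nonneg (hP : SymmetricWeight P) (hlam : 0 < lam) (hs : FreeSol P lam s)
    {c : ℝ} (hc : c ∈ Icc (0:ℝ) 1) (h0 : s c 0 = 0) (h1 : s c 1 = 0) (h2 : 0 ≤ s c 2) : False := by
  have h3 : shear P s c = s c 3 := by rw [shear, h0, mul_zero, zero_add]
  have hne : s c 2 ≠ 0 ∨ shear P s c ≠ 0 := by
    by_contra! h
    rw [h3] at h
    refine hs.apply_ne_zero hP hc ?_
    ext i
    fin_cases i
    exacts [h0, h1, h.1, h.2]
  have forward : c < 1 → 0 ≤ shear P s c → False := fun hc1 h =>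
    (hs.sol.pos_forward hP hlam.le ⟨hc.1, hc1⟩ h0.ge h1.ge h2 h
      (hne.elim (fun h' => .inr (.inr (.inl (h2.lt_of_ne' h'))))
        fun h' => .inr (.inr (.inr (mul_pos hlam (h.lt_of_ne' h')))))).1.ne' hs.shear_one
  have backward : 0 < c → shear P s c ≤ 0 → False := fun hc0 h =>
    (hs.sol.pos_backward hP hlam.le ⟨hc0, hc.2⟩ h0.ge h1.le h2 h
      (hne.elim (fun h' => .inr (.inr (.inl (h2.lt_of_ne' h'))))
        fun h' => .inr (.inr (.inr (mul_neg_of_pos_of_neg hlam (h.lt_of_ne h')))))).ne hs.shear_zero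
  rcases hc.1.eq_or_lt with rfl | hc0
  · exact forward zero_lt_one hs.shear_zero.ge
  rcases hc.2.eq_or_lt with rfl | hc1
  · exact backward zero_lt_one hs.shear_one.le
  exact (le_total 0 (shear P s c)).elim (forward hc1) (backward hc0)

lemma no_double_zero (hP : SymmetricWeight P) (hlam : 0 < lam) (hs : FreeSol P lam s)
    {c : ℝ} (hc : c ∈ Icc (0:ℝ) 1) : s c 0 ≠ 0 ∨ s c 1 ≠ 0 := by
  by_contra! h
  rcases le_total 0 (s c 2) with h2 | h2
  · exact hs.not_both_zero_of_nonneg hP hlam hc h.1 h.2 h2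
  · exact hs.neg.not_both_zero_of_nonneg hP hlam hc (by simp [h.1]) (by simp [h.2]) (by simpa)

lemma false_of_backward (hP : SymmetricWeight P) (hlam : 0 < lam) (hs : FreeSol P lam s)
    (h0 : 0 ≤ s 1 0) (h1 : s 1 1 ≤ 0) (h2 : 0 ≤ s 1 2) : False := by
  refine (hs.sol.pos_backward hP hlam.le (c := 1) (by simp) h0 h1 h2 hs.shear_one.le ?_).ne
    hs.shear_zero
  rcases hs.no_double_zero hP hlam (c := 1) (by simp) with h | h
  · exact .inl (h0.lt_of_ne' h)
  · exact .inr (.inl (h1.lt_of_ne h))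

lemma mul_pos_of_apply_one_eq_zero (hP : SymmetricWeight P) (hlam : 0 < lam)
    (hs : FreeSol P lam s) (h : s 1 0 = 0) : 0 < s 1 1 * s 1 2 := by
  have h1 := (hs.no_double_zero hP hlam (c := 1) (by simp)).resolve_left (fun h' => h' h)
  rcases lt_or_gt_of_ne h1 with h1 | h1
  · refine mul_pos_of_neg_of_neg h1 ?_
    by_contra! h2
    exact hs.false_of_backward hP hlam h.ge h1.le h2
  · refine mul_pos h1 ?_
    by_contra! h2
    exact hs.neg.false_of_backward hP hlam (by simp [h]) (by simpa using h1.le) (by simpa)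

lemma mul_pos_of_boundary (hP : SymmetricWeight P) (hlam : 0 < lam) (hs : FreeSol P lam s)
    {β : ℝ} (hβ : 0 < β) (h : s 1 2 = -β * s 1 1) : 0 < s 1 0 * s 1 1 := by
  have key : ∀ {r : ℝ → Fin 4 → ℝ}, FreeSol P lam r → r 1 2 = -β * r 1 1 → 0 ≤ r 1 0 →
      0 < r 1 1 := by
    intro r hr hb h0
    by_contra! h1
    exact hr.false_of_backward hP hlam h0 h1 (by rw [hb]; nlinarith)
  rcases lt_trichotomy (s 1 0) 0 with h0 | h0 | h0
  · have := key hs.neg (by simp [h]) (by simpa using h0.le)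
    exact mul_pos_of_neg_of_neg h0 (by simpa using this)
  · have h1 := key hs h h0.ge
    have h2 := key hs.neg (by simp [h]) (by simp [h0])
    simp only [Pi.neg_apply] at h2
    linarith
  · exact mul_pos h0 (key hs h h0.le)

lemma stableZeros (hP : SymmetricWeight P) (hlam : 0 < lam) (hs : FreeSol P lam s) :
    StableZeros (fun x => s x 0) (fun x => s x 1) 0 1 :=
  StableZeros.of_forall_ne hs.sol.hasDeriv_zero (hs.sol.continuousOn_apply 1)
    fun _ hx => hs.no_double_zero hP hlam hx

end FreeSol

/-! ### The shooting solution -/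

/-- The solution with initial state `v`. -/
noncomputable def beamSolution {P : ℝ → ℝ} (hP : SymmetricWeight P) (lam : ℝ) (v : Fin 4 → ℝ) :
    ℝ → Fin 4 → ℝ := (exists_beamSol hP lam v).choose

lemma beamSolution_zero {P : ℝ → ℝ} (hP : SymmetricWeight P) (lam : ℝ) (v : Fin 4 → ℝ) :
    beamSolution hP lam v 0 = v := (exists_beamSol hP lam v).choose_spec.1

lemma beamSol_beamSolution {P : ℝ → ℝ} (hP : SymmetricWeight P) (lam : ℝ) (v : Fin 4 → ℝ) :
    BeamSol P lam (beamSolution hP lam v) := (exists_beamSol hP lam v).choose_spec.2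

/-- The third derivative at `1`, divided by the parameter, of the solution with initial state
`v`. -/
noncomputable def endShear {P : ℝ → ℝ} (hP : SymmetricWeight P) (v : Fin 4 → ℝ) (lam : ℝ) : ℝ :=
  shear P (beamSolution hP lam v) 1

lemma BeamSol.eventually_close {P : ℝ → ℝ} (hP : SymmetricWeight P) {r : ℝ → ℝ → Fin 4 → ℝ}
    (hr : ∀ lam, BeamSol P lam (r lam)) (h0 : Continuous fun lam => r lam 0) (lam₀ : ℝ) {ε : ℝ}
    (hε : 0 < ε) :
    ∀ᶠ lam in nhds lam₀, ∀ x ∈ Icc (0:ℝ) 1, ∀ i, |r lam x i - r lam₀ x i| < ε := by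
  obtain ⟨C, hC0, hC⟩ := (hr lam₀).exists_dist_le hP
  have ht : Tendsto (fun lam => C * (‖r lam 0 - r lam₀ 0‖ + |lam - lam₀|)) (nhds lam₀)
      (nhds 0) := by
    have : Continuous fun lam => C * (‖r lam 0 - r lam₀ 0‖ + |lam - lam₀|) := by fun_prop
    simpa using this.tendsto lam₀
  filter_upwards [ht.eventually (gt_mem_nhds hε), Metric.ball_mem_nhds lam₀ one_pos]
    with lam h1 h2 x hx i
  have h3 := hC lam (by simpa [Real.dist_eq] using (Metric.mem_ball.1 h2).le) _ (hr lam) x hx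
  exact ((norm_le_pi_norm (r lam x - r lam₀ x) i).trans h3).trans_lt h1

lemma continuous_endShear {P : ℝ → ℝ} (hP : SymmetricWeight P) (v : Fin 4 → ℝ) :
    Continuous (endShear hP v) := by
  have hc : ∀ i, Continuous fun lam => beamSolution hP lam v 1 i := fun i =>
    continuous_iff_continuousAt.2 fun lam₀ => Metric.tendsto_nhds.2 fun ε hε => by
      filter_upwards [BeamSol.eventually_close hP (fun lam => beamSol_beamSolution hP lam v)
        (by simpa only [beamSolution_zero] using continuous_const) lam₀ hε] with lam h
      exact h 1 (by simp) i
  exact ((hc 0).const_mul _).add (hc 3)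

/-- The solution satisfying the boundary conditions at `0` whose third derivative vanishes at
`1`. -/
noncomputable def shootSol {P : ℝ → ℝ} (hP : SymmetricWeight P) (β lam x : ℝ) : Fin 4 → ℝ :=
  endShear hP ![0, 1, β, 0] lam • beamSolution hP lam ![1, 0, 0, 0] x -
    endShear hP ![1, 0, 0, 0] lam • beamSolution hP lam ![0, 1, β, 0] x

section Shooting

variable {P : ℝ → ℝ} (hP : SymmetricWeight P) {β lam : ℝ}

lemma beamSol_shootSol (β lam : ℝ) : BeamSol P lam (shootSol hP β lam) :=
  ((beamSol_beamSolution hP lam _).smul _).sub ((beamSol_beamSolution hP lam _).smul _)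

lemma shootSol_zero (β lam : ℝ) : shootSol hP β lam 0 =
    ![endShear hP ![0, 1, β, 0] lam, -endShear hP ![1, 0, 0, 0] lam,
      -β * endShear hP ![1, 0, 0, 0] lam, 0] := by
  rw [shootSol, beamSolution_zero, beamSolution_zero]
  ext i
  fin_cases i <;> simp
  ring

lemma endShear_pos_left (hlam : 0 ≤ lam) : 0 < endShear hP ![1, 0, 0, 0] lam := by
  have h := beamSolution_zero hP lam ![1, 0, 0, 0]
  exact ((beamSol_beamSolution hP lam _).pos_forward hP hlam (c := 0) (by simp) (by simp [h])
    (by simp [h]) (by simp [h]) (by simp [shear, hP.zero, h]) (by simp [h])).1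

lemma endShear_pos_right (hβ : 0 < β) (hlam : 0 ≤ lam) : 0 < endShear hP ![0, 1, β, 0] lam := by
  have h := beamSolution_zero hP lam ![0, 1, β, 0]
  exact ((beamSol_beamSolution hP lam _).pos_forward hP hlam (c := 0) (by simp) (by simp [h])
    (by simp [h]) (by simp [h, hβ.le]) (by simp [shear, hP.zero, h]) (by simp [h])).1

lemma freeSol_shootSol (hβ : 0 < β) (hlam : 0 ≤ lam) : FreeSol P lam (shootSol hP β lam) where
  sol := beamSol_shootSol hP β lam
  ne h := by
    have := congrFun h 0
    rw [shootSol_zero] at this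
    exact (endShear_pos_right hP hβ hlam).ne' this
  shear_zero := by simp [shear, hP.zero, shootSol_zero]
  shear_one := by
    have hA : endShear hP ![0, 1, β, 0] lam = shear P (beamSolution hP lam ![0, 1, β, 0]) 1 := rfl
    have hB : endShear hP ![1, 0, 0, 0] lam = shear P (beamSolution hP lam ![1, 0, 0, 0]) 1 := rfl
    simp only [shear] at hA hB
    simp only [shear, shootSol, Pi.sub_apply, Pi.smul_apply, smul_eq_mul]
    rw [hA, hB]
    ring

lemma eventually_shootSol_close (β lam₀ : ℝ) {ε : ℝ} (hε : 0 < ε) :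
    ∀ᶠ lam in nhds lam₀, ∀ x ∈ Icc (0:ℝ) 1, ∀ i,
      |shootSol hP β lam x i - shootSol hP β lam₀ x i| < ε := by
  refine BeamSol.eventually_close hP (beamSol_shootSol hP β) ?_ lam₀ hε
  simp only [shootSol, beamSolution_zero]
  have := continuous_endShear hP
  exact ((this _).smul continuous_const).sub ((this _).smul continuous_const)

lemma continuous_shootSol_one (β : ℝ) (i : Fin 4) : Continuous fun lam => shootSol hP β lam 1 i :=
  continuous_iff_continuousAt.2 fun lam₀ => Metric.tendsto_nhds.2 fun ε hε => by
    filter_upwards [eventually_shootSol_close hP β lam₀ hε] with lam h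
    exact h 1 (by simp) i

/-- The defect of the remaining boundary condition at `1`. -/
noncomputable def shootDefect (β lam : ℝ) : ℝ :=
  shootSol hP β lam 1 2 + β * shootSol hP β lam 1 1

lemma continuous_shootDefect (β : ℝ) : Continuous (shootDefect hP β) :=
  (continuous_shootSol_one hP β 2).add ((continuous_shootSol_one hP β 1).const_mul β)

/-- Every solution satisfying the boundary conditions at `0` whose third derivative vanishes at
`1` is a multiple of the shooting solution. -/
lemma FreeSol.exists_eqOn_shootSol {s : ℝ → Fin 4 → ℝ} (hβ : 0 < β) (hlam : 0 ≤ lam)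
    (hs : FreeSol P lam s) (h : s 0 2 = β * s 0 1) :
    ∃ c : ℝ, c ≠ 0 ∧ EqOn s (fun x => c • shootSol hP β lam x) (Icc 0 1) := by
  have h3 : s 0 3 = 0 := by simpa [shear, hP.zero] using hs.shear_zero
  have hA := endShear_pos_right hP hβ hlam
  have e := hs.sol.eqOn hP (((beamSol_beamSolution hP lam ![1, 0, 0, 0]).smul (s 0 0)).sub
    ((beamSol_beamSolution hP lam ![0, 1, β, 0]).smul (-s 0 1))) (by
      simp only [beamSolution_zero]
      ext i
      fin_cases i <;> simp [h3, h, mul_comm]) (right_mem_Icc.2 zero_le_one)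
  have h1 : s 0 0 * endShear hP ![1, 0, 0, 0] lam + s 0 1 * endShear hP ![0, 1, β, 0] lam = 0 := by
    have e0 := congrFun e 0
    have e3 := congrFun e 3
    have := hs.shear_one
    simp only [shear, Pi.sub_apply, Pi.smul_apply, smul_eq_mul] at e0 e3 this
    simp only [endShear, shear]
    linear_combination this - P 1 * e0 - e3
  have hc : s 0 = (s 0 0 / endShear hP ![0, 1, β, 0] lam) • shootSol hP β lam 0 := by
    rw [shootSol_zero]
    ext i
    fin_cases i <;> simp [h3, h] <;> field_simp <;> linear_combination h1
  refine ⟨s 0 0 / endShear hP ![0, 1, β, 0] lam, fun h0 => hs.ne (by rw [hc, h0, zero_smul]),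
    hs.sol.eqOn hP ((beamSol_shootSol hP β lam).smul _) hc⟩

end Shooting

/-! ### The number of zeros of the shooting solution -/

lemma exists_forall_Icc_lt {f : ℝ → ℝ} (hf : ContinuousOn f (Icc 0 1)) {c : ℝ} (h : c < f 0) :
    ∃ δ ∈ Ioc (0:ℝ) 1, ∀ x ∈ Icc 0 δ, c < f x := by
  obtain ⟨d, hd, H⟩ := Metric.continuousOn_iff.1 hf 0 (by simp) (f 0 - c) (sub_pos.2 h)
  refine ⟨min (d / 2) 1, ⟨by positivity, min_le_right _ _⟩, fun x hx => ?_⟩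
  have := H x ⟨hx.1, hx.2.trans (min_le_right _ _)⟩ (by
    rw [Real.dist_eq, sub_zero, abs_of_nonneg hx.1]
    linarith [hx.2.trans (min_le_left _ _)])
  rw [Real.dist_eq] at this
  linarith [(abs_lt.1 this).1]

/-- Green identity, in the form of an inequality. -/
lemma BeamSol.le_green {P : ℝ → ℝ} (hP : SymmetricWeight P) {lam mu : ℝ} (hne : mu ≠ lam)
    {s r : ℝ → Fin 4 → ℝ} (hs : BeamSol P lam s) (hr : BeamSol P mu r) {c d m : ℝ} (hc : 0 ≤ c)
    (hcd : c ≤ d) (hd : d ≤ 1) (hm : ∀ x ∈ Icc c d, m ≤ s x 0 * r x 0) :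
    m * (P d - P c) ≤
      (mu * shear P r d * s d 0 - r d 2 * s d 1 + r d 1 * s d 2 - r d 0 * (lam * shear P s d))
        / (mu - lam) -
      (mu * shear P r c * s c 0 - r c 2 * s c 1 + r c 1 * s c 2 - r c 0 * (lam * shear P s c))
        / (mu - lam) := by
  have hsub : Icc c d ⊆ Icc (0:ℝ) 1 := Icc_subset_Icc hc hd
  have hml : mu - lam ≠ 0 := sub_ne_zero.2 hne
  have hcont : ContinuousOn (fun x => s x 1 * r x 0 + s x 0 * r x 1) (Icc 0 1) :=
    ((hs.continuousOn_apply 1).mul (hr.continuousOn_apply 0)).add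
      ((hs.continuousOn_apply 0).mul (hr.continuousOn_apply 1))
  obtain ⟨C, hC⟩ := isCompact_Icc.exists_bound_of_continuousOn hcont
  have key := le_stieltjes_increment (P := P) (h := fun x => s x 0 * r x 0)
    (h1 := fun x => s x 1 * r x 0 + s x 0 * r x 1)
    (G := fun x => (mu * (r x 3 * s x 0) - r x 2 * s x 1 + r x 1 * s x 2
      - lam * (r x 0 * s x 3)) / (mu - lam))
    (G1 := fun x => (mu * (-(P x * r x 1) * s x 0 + r x 3 * s x 1)
      - (mu * shear P r x * s x 1 + r x 2 * s x 2) + (r x 2 * s x 2 + r x 1 * (lam * shear P s x))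
      - lam * (r x 1 * s x 3 + r x 0 * -(P x * s x 1))) / (mu - lam)) hcd (hP.mono.mono hsub)
    (fun x hx => ((hs.hasDeriv_zero x (hsub hx)).mul (hr.hasDeriv_zero x (hsub hx))).mono hsub)
    (fun x hx => by
      have hx' := hsub hx
      exact ((((((hr.hasDeriv_three x hx').mul (hs.hasDeriv_zero x hx')).const_mul mu).sub
        ((hr.hasDeriv_two x hx').mul (hs.hasDeriv_one x hx'))).add
        ((hr.hasDeriv_one x hx').mul (hs.hasDeriv_two x hx'))).sub
        (((hr.hasDeriv_zero x hx').mul (hs.hasDeriv_three x hx')).const_mul lam)).div_const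
          (mu - lam) |>.mono hsub)
    (fun x hx => le_of_eq <| by
      rw [eq_div_iff hml]
      simp only [shear]
      ring)
    (fun x hx => hC x (hsub hx)) hm
  refine key.trans_eq ?_
  simp only [shear]
  field_simp
  ring

section Shooting

variable {P : ℝ → ℝ} (hP : SymmetricWeight P) {β lam : ℝ}

/-- Transversality: the defect crosses zero with a definite sign. -/
lemma eventually_shootDefect_sign (hβ : 0 < β) (hlam : 0 < lam) (h : shootDefect hP β lam = 0) :
    ∀ᶠ mu in nhds lam, mu ≠ lam →
      shootSol hP β lam 1 1 * shootDefect hP β mu / (mu - lam) < 0 := by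
  set s := shootSol hP β lam with hs_def
  have hs := freeSol_shootSol hP hβ hlam.le
  have hA : 0 < s 0 0 := by
    rw [hs_def, shootSol_zero]
    exact endShear_pos_right hP hβ hlam.le
  obtain ⟨δ, hδ, hδpos⟩ := exists_forall_Icc_lt (hs.sol.continuousOn_apply 0) (half_lt_self hA)
  have hδ' : δ ∈ Icc (0:ℝ) 1 := Ioc_subset_Icc_self hδ
  have hPδ := hP.pos δ hδ
  set A := s 0 0
  set ε := min (A / 4) (A * P δ / 4) with hε
  have hε0 : 0 < ε := by positivity
  filter_upwards [eventually_shootSol_close hP β lam hε0, lt_mem_nhds hlam] with mu hclose hmu hne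
  set r := shootSol hP β mu with hr_def
  have hr := freeSol_shootSol hP hβ hmu.le
  have hεA : ε ≤ A / 4 := min_le_left _ _
  have h1 := hs.sol.le_green hP hne hr.sol (c := 0) (d := δ) (m := A ^ 2 / 8) le_rfl hδ.1.le hδ.2
    fun x hx => by
      have hc := abs_lt.1 (hclose x ⟨hx.1, hx.2.trans hδ.2⟩ 0)
      have hx' := hδpos x hx
      nlinarith [hc.1]
  have h2 := hs.sol.le_green hP hne hr.sol (c := δ) (d := 1) (m := -(ε ^ 2 / 4)) hδ.1.le hδ.2 le_rfl
    fun x hx => by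
      have hc := abs_lt.1 (hclose x ⟨hδ.1.le.trans hx.1, hx.2⟩ 0)
      nlinarith [sq_nonneg (s x 0 + r x 0), sq_nonneg (s x 0 - r x 0)]
  have hb0 : mu * shear P r 0 * s 0 0 - r 0 2 * s 0 1 + r 0 1 * s 0 2
      - r 0 0 * (lam * shear P s 0) = 0 := by
    rw [hs.shear_zero, hr.shear_zero, hs_def, hr_def, shootSol_zero, shootSol_zero]
    simp
    ring
  have hb1 : mu * shear P r 1 * s 1 0 - r 1 2 * s 1 1 + r 1 1 * s 1 2
      - r 1 0 * (lam * shear P s 1) = -(s 1 1 * shootDefect hP β mu) := by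
    rw [hs.shear_one, hr.shear_one]
    simp only [shootDefect] at h ⊢
    linear_combination r 1 1 * h
  rw [hb0, hP.zero, zero_div, sub_zero, sub_zero] at h1
  rw [hb1, hP.one, neg_div] at h2
  have h3 : ε ^ 2 ≤ A / 4 * (A * P δ / 4) := by
    rw [sq]
    exact mul_le_mul hεA (min_le_right _ _) hε0.le (by positivity)
  have h4 : ε ^ 2 / 4 * (1 - P δ) ≤ ε ^ 2 / 4 :=
    mul_le_of_le_one_right (by positivity) (by linarith)
  have h5 : 0 < A ^ 2 * P δ := by positivity
  have h6 := h1.trans (le_sub_comm.1 h2)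
  linarith

open Classical in
/-- The number of zeros of the shooting solution, corrected by the sign at the end point. -/
noncomputable def shootCount (β lam : ℝ) : ℕ∞ :=
  zeroCount (fun x => shootSol hP β lam x 0) 0 1 +
    if shootSol hP β lam 1 0 * shootDefect hP β lam ≤ 0 then 1 else 0

lemma eventually_zeroCount_shootSol (hβ : 0 < β) (hlam : 0 ≤ lam)
    (hst : StableZeros (fun x => shootSol hP β lam x 0) (fun x => shootSol hP β lam x 1) 0 1) :
    ∀ᶠ mu in nhds lam, zeroCount (fun x => shootSol hP β mu x 0) 0 1 =
      zeroCount (fun x => shootSol hP β lam x 0) 0 1 +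
        zeroShift (fun x => shootSol hP β lam x 0) (fun x => shootSol hP β lam x 1)
          (fun x => shootSol hP β mu x 0) 1 := by
  obtain ⟨-, ε, hε, H⟩ := hst
  filter_upwards [eventually_shootSol_close hP β lam hε] with mu hclose
  have := H (fun x => shootSol hP β mu x 0) (fun x => shootSol hP β mu x 1)
    (beamSol_shootSol hP β mu).hasDeriv_zero fun x hx => ⟨hclose x hx 0, hclose x hx 1⟩
  rwa [zeroShift_of_ne (x := 0), add_zero] at this
  simpa [shootSol_zero] using (endShear_pos_right hP hβ hlam).ne'

lemma eventually_shootCount_eq_of_stable (hβ : 0 < β) (hlam : 0 ≤ lam)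
    (hst : StableZeros (fun x => shootSol hP β lam x 0) (fun x => shootSol hP β lam x 1) 0 1)
    (hd : shootDefect hP β lam ≠ 0)
    (h : shootSol hP β lam 1 0 = 0 → 0 < shootDefect hP β lam * shootSol hP β lam 1 1) :
    ∀ᶠ mu in nhds lam, shootCount hP β mu = shootCount hP β lam := by
  classical
  have hcd := continuous_shootDefect hP β
  have hcw := continuous_shootSol_one hP β 0
  by_cases hw : shootSol hP β lam 1 0 = 0
  · have hd1 := h hw
    have hp := right_ne_zero_of_mul hd1.ne'
    filter_upwards [eventually_zeroCount_shootSol hP hβ hlam hst,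
      (hcd.mul continuous_const).continuousAt.eventually (lt_mem_nhds hd1)] with mu hz hdmu
    rw [shootCount, shootCount, hz, hw, zero_mul, if_pos le_rfl, add_assoc]
    congr 1
    have hiff : (0 < shootSol hP β mu 1 0 * shootSol hP β lam 1 1) ↔
        ¬ shootSol hP β mu 1 0 * shootDefect hP β mu ≤ 0 := by
      rw [not_le]
      rcases lt_trichotomy (shootSol hP β lam 1 1) 0 with h1 | h1 | h1
      · have := neg_of_mul_pos_left hdmu h1.le
        rw [← neg_mul_neg, mul_pos_iff_of_pos_right (neg_pos.2 h1), ← neg_mul_neg,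
          mul_pos_iff_of_pos_right (neg_pos.2 this)]
      · exact absurd h1 hp
      · have := pos_of_mul_pos_left hdmu h1.le
        rw [mul_pos_iff_of_pos_right h1, mul_pos_iff_of_pos_right this]
    simp only [zeroShift, hw, true_and, hiff]
    split_ifs <;> simp
  · have hne : shootSol hP β lam 1 0 * shootDefect hP β lam ≠ 0 := mul_ne_zero hw hd
    have hsign : ∀ᶠ mu in nhds lam, (shootSol hP β mu 1 0 * shootDefect hP β mu ≤ 0 ↔
        shootSol hP β lam 1 0 * shootDefect hP β lam ≤ 0) := by
      rcases lt_or_gt_of_ne hne with h0 | h0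
      · filter_upwards [(hcw.mul hcd).continuousAt.eventually (gt_mem_nhds h0)] with mu hmu
        exact ⟨fun _ => h0.le, fun _ => hmu.le⟩
      · filter_upwards [(hcw.mul hcd).continuousAt.eventually (lt_mem_nhds h0)] with mu hmu
        exact ⟨fun h => absurd hmu h.not_gt, fun h => absurd h0 h.not_gt⟩
    filter_upwards [eventually_zeroCount_shootSol hP hβ hlam hst, hsign] with mu hz hs
    rw [shootCount, shootCount, hz, zeroShift_of_ne (x := 1) hw, add_zero]
    simp only [hs]

lemma eventually_shootCount_eq_of_pos (hβ : 0 < β) (hlam : 0 < lam)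
    (hd : shootDefect hP β lam ≠ 0) :
    ∀ᶠ mu in nhds lam, shootCount hP β mu = shootCount hP β lam := by
  have hs := freeSol_shootSol hP hβ hlam.le
  refine eventually_shootCount_eq_of_stable hP hβ hlam.le (hs.stableZeros hP hlam) hd fun h0 => ?_
  have h1 := hs.mul_pos_of_apply_one_eq_zero hP hlam h0
  rw [shootDefect]
  nlinarith [mul_nonneg hβ.le (sq_nonneg (shootSol hP β lam 1 1))]

lemma eventually_shootCount_at_eigenvalue (hβ : 0 < β) (hlam : 0 < lam)
    (hd : shootDefect hP β lam = 0) :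
    ∀ᶠ mu in nhds lam,
      (mu < lam → shootCount hP β mu = zeroCount (fun x => shootSol hP β lam x 0) 0 1) ∧
      (lam < mu → shootCount hP β mu = zeroCount (fun x => shootSol hP β lam x 0) 0 1 + 1) := by
  have hs := freeSol_shootSol hP hβ hlam.le
  have hw := hs.mul_pos_of_boundary hP hlam hβ (by rw [shootDefect] at hd; linarith)
  have hw0 : shootSol hP β lam 1 0 ≠ 0 := left_ne_zero_of_mul hw.ne'
  filter_upwards [eventually_zeroCount_shootSol hP hβ hlam.le (hs.stableZeros hP hlam),
    eventually_shootDefect_sign hP hβ hlam hd,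
    ((continuous_shootSol_one hP β 0).mul continuous_const).continuousAt.eventually
      (lt_mem_nhds hw)] with mu hz hsign hwmu
  rw [zeroShift_of_ne (x := 1) hw0, add_zero] at hz
  rw [shootCount, hz]
  set p := shootSol hP β lam 1 1
  set w := shootSol hP β mu 1 0
  set e := shootDefect hP β mu
  replace hwmu : 0 < w * p := hwmu
  have hp2 : 0 < p ^ 2 := by
    have : p ≠ 0 := right_ne_zero_of_mul hwmu.ne'
    positivity
  have hprod : (w * e) * p ^ 2 = (w * p) * (p * e) := by ring
  constructor
  · intro hlt
    have h1 := hsign hlt.ne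
    rw [div_neg_iff] at h1
    have hpe : 0 < p * e := by
      rcases h1 with h1 | h1
      · exact h1.1
      · linarith [h1.2]
    have : 0 < w * e := pos_of_mul_pos_left (hprod ▸ mul_pos hwmu hpe) hp2.le
    rw [if_neg this.not_ge, add_zero]
  · intro hlt
    have h1 := hsign hlt.ne'
    rw [div_neg_iff] at h1
    have hpe : p * e < 0 := by
      rcases h1 with h1 | h1
      · linarith [h1.2]
      · exact h1.1
    have : w * e < 0 := by
      by_contra! hcon
      nlinarith [mul_nonneg hcon hp2.le, mul_neg_of_pos_of_neg hwmu hpe]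
    rw [if_pos this.le]

lemma shootCount_eq_zeroCount {lam : ℝ} (h : 0 < shootSol hP β lam 1 0 * shootDefect hP β lam) :
    shootCount hP β lam = zeroCount (fun x => shootSol hP β lam x 0) 0 1 := by
  rw [shootCount, if_neg h.not_ge, add_zero]

/-- At the parameter `0` the shooting solution is decreasing and changes sign. -/
lemma eventually_shootCount_zero (hβ : 0 < β) : shootCount hP β 0 = 1 ∧
    ∀ᶠ mu in nhds 0, shootCount hP β mu = shootCount hP β 0 := by
  have hs := freeSol_shootSol hP hβ le_rfl
  have hst := eventually_shootCount_eq_of_stable hP hβ le_rfl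
  have hcount := shootCount_eq_zeroCount hP (β := β) (lam := 0)
  have hB := endShear_pos_left hP le_rfl
  have hA := endShear_pos_right hP hβ le_rfl
  have h00 : shootSol hP β 0 0 0 = endShear hP ![0, 1, β, 0] 0 := by simp [shootSol_zero]
  have h01 : shootSol hP β 0 0 1 = -endShear hP ![1, 0, 0, 0] 0 := by simp [shootSol_zero]
  have h02 : shootSol hP β 0 0 2 = -β * endShear hP ![1, 0, 0, 0] 0 := by simp [shootSol_zero]
  rw [shootDefect] at hst hcount
  set s := shootSol hP β 0
  have mono2 := monotoneOn_Icc_of_deriv_nonneg le_rfl le_rfl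
    (fun x hx => (hs.sol.hasDeriv_two x hx).neg) fun x _ => by simp
  have h2 : ∀ x ∈ Icc (0:ℝ) 1, s x 2 < 0 := fun x hx => by
    have := mono2 (left_mem_Icc.2 zero_le_one) hx hx.1
    simp only [Pi.neg_apply] at this
    nlinarith
  have mono1 := monotoneOn_Icc_of_deriv_nonneg le_rfl le_rfl
    (fun x hx => (hs.sol.hasDeriv_one x hx).neg) fun x hx =>
      neg_nonneg.2 (h2 x (Ioo_subset_Icc_self hx)).le
  have h1 : ∀ x ∈ Icc (0:ℝ) 1, s x 1 < 0 := fun x hx => by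
    have := mono1 (left_mem_Icc.2 zero_le_one) hx hx.1
    simp only [Pi.neg_apply] at this
    linarith
  have mono0 : StrictMonoOn (fun x => -s x 0) (Icc 0 1) :=
    StableZeros.strictMonoOn_of_pos le_rfl le_rfl (fun x hx => (hs.sol.hasDeriv_zero x hx).neg)
      fun x hx => neg_pos.2 (h1 x hx)
  have m1 : (1:ℝ) ∈ Icc (0:ℝ) 1 := by simp
  have mhalf : (1 / 2 : ℝ) ∈ Icc (0:ℝ) 1 := by norm_num
  have hw : s 1 0 < 0 := by
    by_contra! hw
    have hle : ∀ x ∈ Icc (0:ℝ) 1, ∀ z ∈ Icc (0:ℝ) 1, x ≤ z → s z 0 ≤ s x 0 := fun x hx z hz h =>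
      neg_le_neg_iff.1 (mono0.monotoneOn hx hz h)
    have hhalf : 0 < s (1 / 2) 0 := hw.trans_lt (neg_lt_neg_iff.1 (mono0 mhalf m1 (by norm_num)))
    have i1 := hs.sol.le_shear_sub hP (c := 0) (d := 1 / 2) (m := s (1 / 2) 0) le_rfl (by norm_num)
      (by norm_num) fun x hx => hle x ⟨hx.1, hx.2.trans (by norm_num)⟩ _ mhalf hx.2
    have i2 := hs.sol.shear_mono hP (c := 0) le_rfl le_rfl
      (fun x hx => hw.trans (hle x (Ioo_subset_Icc_self hx) 1 m1 hx.2.le)) mhalf m1 (by norm_num)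
    rw [hs.shear_zero, hP.zero] at i1
    rw [hs.shear_one] at i2
    nlinarith [hP.pos (1 / 2) (by norm_num)]
  have hE : s 1 2 + β * s 1 1 < 0 := by nlinarith [h2 1 m1, h1 1 m1]
  constructor
  · rw [hcount (mul_pos_of_neg_of_neg hw hE), ← zeroCount_neg,
      zeroCount_of_strictMonoOn (g := fun x => -s x 0) zero_lt_one (hs.sol.continuousOn_apply 0).neg mono0, if_pos]
    exact ⟨by linarith, by linarith⟩
  · exact hst (StableZeros.of_forall_ne hs.sol.hasDeriv_zero (hs.sol.continuousOn_apply 1)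
      fun x hx => .inr (h1 x hx).ne) hE.ne fun h => absurd h hw.ne

lemma shootCount_eq_of_isPreconnected {S : Set ℝ} (hS : IsPreconnected S)
    (h : ∀ lam ∈ S, ∀ᶠ mu in nhds lam, shootCount hP β mu = shootCount hP β lam)
    {x z : ℝ} (hx : x ∈ S) (hz : z ∈ S) : shootCount hP β x = shootCount hP β z := by
  have := isPreconnected_iff_preconnectedSpace.1 hS
  have hloc : IsLocallyConstant fun t : S => shootCount hP β t :=
    (IsLocallyConstant.iff_eventually_eq _).2 fun t =>
      continuous_subtype_val.continuousAt.eventually (h t t.2)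
  exact hloc.apply_eq_of_preconnectedSpace ⟨x, hx⟩ ⟨z, hz⟩

lemma zeroCount_shootSol_of_enumeration (hβ : 0 < β) {Λ : ℕ → ℝ} (hmono : StrictMono Λ)
    (h0 : Λ 0 = 0) (hΛ : ∀ lam > 0, shootDefect hP β lam = 0 ↔ lam ∈ range Λ) (n : ℕ) :
    zeroCount (fun x => shootSol hP β (Λ (n + 1)) x 0) 0 1 = (n + 1 : ℕ) := by
  have hpos : ∀ n, 0 < Λ (n + 1) := fun n => h0 ▸ hmono n.succ_pos
  have hat := fun n => eventually_shootCount_at_eigenvalue hP hβ (hpos n)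
    ((hΛ _ (hpos n)).2 (mem_range_self _))
  have hgap : ∀ n, ∀ lam ∈ Ioo (Λ n) (Λ (n + 1)), 0 < lam →
      ∀ᶠ mu in nhds lam, shootCount hP β mu = shootCount hP β lam := by
    intro n lam hlam hlam0
    refine eventually_shootCount_eq_of_pos hP hβ hlam0 fun h => ?_
    obtain ⟨m, rfl⟩ := (hΛ lam hlam0).1 h
    have h1 := hmono.lt_iff_lt.1 hlam.1
    have h2 := hmono.lt_iff_lt.1 hlam.2
    omega
  have hbelow : ∀ n, ∃ x ∈ Ioo (Λ n) (Λ (n + 1)),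
      shootCount hP β x = zeroCount (fun x => shootSol hP β (Λ (n + 1)) x 0) 0 1 := by
    intro n
    obtain ⟨x, hx, hx'⟩ := (((hat n).filter_mono nhdsWithin_le_nhds).and
      (Ioo_mem_nhdsLT (hmono n.lt_succ_self))).exists
    exact ⟨x, hx', hx.1 hx'.2⟩
  induction n with
  | zero =>
    obtain ⟨hz1, hz2⟩ := eventually_shootCount_zero hP hβ
    obtain ⟨x, hx, hxc⟩ := hbelow 0
    rw [h0] at hx
    have := shootCount_eq_of_isPreconnected hP (isPreconnected_Ico (a := 0) (b := Λ 1))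
      (fun lam hlam => by
        rcases hlam.1.eq_or_lt with rfl | hlt
        · exact hz2
        · exact hgap 0 lam ⟨h0 ▸ hlt, hlam.2⟩ hlt) (left_mem_Ico.2 (hpos 0))
      (Ioo_subset_Ico_self hx)
    rw [← hxc, ← this, hz1]
    norm_num
  | succ n ih =>
    obtain ⟨x, hx, hxc⟩ := hbelow (n + 1)
    obtain ⟨z, hz, hz'⟩ := (((hat n).filter_mono nhdsWithin_le_nhds).and
      (Ioo_mem_nhdsGT (hmono (n + 1).lt_succ_self))).exists
    have := shootCount_eq_of_isPreconnected hP isPreconnected_Ioo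
      (fun lam hlam => hgap (n + 1) lam hlam ((hpos n).trans hlam.1)) hz' hx
    rw [← hxc, ← this, hz.2 hz'.1, ih]
    norm_cast

end Shooting

/-! ### Eigenvalues -/

/-- A solution, as a state vector, of the boundary value problem with `α = 0`. -/
structure EigenSol (P : ℝ → ℝ) (β lam : ℝ) (s : ℝ → Fin 4 → ℝ) : Prop where
  free : FreeSol P lam s
  left : s 0 2 = β * s 0 1
  right : s 1 2 = -β * s 1 1

lemma hasDerivWithinAt_Y {P : ℝ → ℝ} {lam : ℝ} {y : ℝ → ℝ} (h : SolutionOn P lam y) {x : ℝ}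
    (hx : x ∈ Icc (0:ℝ) 1) :
    HasDerivWithinAt y (Y1 y x) (Icc 0 1) x ∧ HasDerivWithinAt (Y1 y) (Y2 y x) (Icc 0 1) x ∧
      HasDerivWithinAt (Y2 y) (Y3 y x) (Icc 0 1) x := by
  have hu : UniqueDiffOn ℝ (Icc (0:ℝ) 1) := uniqueDiffOn_Icc zero_lt_one
  have key : ∀ m : ℕ, m < 3 → HasDerivWithinAt (iteratedDerivWithin m y (Icc 0 1))
      (iteratedDerivWithin (m + 1) y (Icc 0 1) x) (Icc 0 1) x := by
    intro m hm
    rw [iteratedDerivWithin_succ]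
    exact (h.1.differentiableOn_iteratedDerivWithin (by exact_mod_cast hm) hu x
      hx).hasDerivWithinAt
  have h0 := key 0 (by norm_num)
  have h1 := key 1 (by norm_num)
  rw [iteratedDerivWithin_zero] at h0
  have e1 : iteratedDerivWithin 1 y (Icc 0 1) = Y1 y := iteratedDerivWithin_one
  rw [zero_add, e1] at h0
  rw [e1] at h1
  exact ⟨h0, h1, key 2 (by norm_num)⟩

lemma SolutionOn.beamSol {P : ℝ → ℝ} {lam : ℝ} (hlam : lam ≠ 0) {y : ℝ → ℝ}
    (h : SolutionOn P lam y) :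
    BeamSol P lam fun x => ![y x, Y1 y x, Y2 y x, Y3 y x / lam - P x * y x] := by
  intro x hx
  obtain ⟨h0, h1, h2⟩ := hasDerivWithinAt_Y h hx
  have h3 := (h.2 x hx).div_const lam
  rw [hasDerivWithinAt_pi]
  intro i
  fin_cases i
  · exact h0
  · exact h1
  · refine h2.congr_deriv ?_
    simp [beamField]
    field_simp
  · refine (h3.congr_deriv ?_).congr_of_mem (fun t _ => ?_) hx
    · simp [beamField]
      field_simp
    · simp
      field_simp

lemma contDiffOn_succ_of_hasDerivWithinAt {f g : ℝ → ℝ} {n : ℕ} (hg : ContDiffOn ℝ n g (Icc 0 1))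
    (h : ∀ x ∈ Icc (0:ℝ) 1, HasDerivWithinAt f (g x) (Icc 0 1) x) :
    ContDiffOn ℝ (n + 1 : ℕ) f (Icc 0 1) := by
  have hu : UniqueDiffOn ℝ (Icc (0:ℝ) 1) := uniqueDiffOn_Icc zero_lt_one
  push_cast
  refine (contDiffOn_succ_iff_derivWithin hu).2 ⟨fun x hx => (h x hx).differentiableWithinAt,
    fun h => absurd h (by simp), hg.congr fun x hx => (h x hx).derivWithin (hu x hx)⟩

lemma BeamSol.solutionOn {P : ℝ → ℝ} (hP : SymmetricWeight P) {lam : ℝ} {s : ℝ → Fin 4 → ℝ}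
    (hs : BeamSol P lam s) : SolutionOn P lam (fun x => s x 0) ∧ ∀ x ∈ Icc (0:ℝ) 1,
      Y1 (fun x => s x 0) x = s x 1 ∧ Y2 (fun x => s x 0) x = s x 2 ∧
        Y3 (fun x => s x 0) x = lam * shear P s x := by
  have hu : UniqueDiffOn ℝ (Icc (0:ℝ) 1) := uniqueDiffOn_Icc zero_lt_one
  have e1 : ∀ x ∈ Icc (0:ℝ) 1, Y1 (fun x => s x 0) x = s x 1 := fun x hx =>
    (hs.hasDeriv_zero x hx).derivWithin (hu x hx)
  have e2 : ∀ x ∈ Icc (0:ℝ) 1, Y2 (fun x => s x 0) x = s x 2 := fun x hx => by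
    rw [Y2, iteratedDerivWithin_succ, iteratedDerivWithin_one]
    exact ((hs.hasDeriv_one x hx).congr_of_mem e1 hx).derivWithin (hu x hx)
  have e3 : ∀ x ∈ Icc (0:ℝ) 1, Y3 (fun x => s x 0) x = lam * shear P s x := fun x hx => by
    rw [Y3, iteratedDerivWithin_succ]
    exact ((hs.hasDeriv_two x hx).congr_of_mem e2 hx).derivWithin (hu x hx)
  refine ⟨⟨?_, fun x hx => ?_⟩, fun x hx => ⟨e1 x hx, e2 x hx, e3 x hx⟩⟩
  · have c0 : ContDiffOn ℝ (0:ℕ) (fun x => lam * shear P s x) (Icc 0 1) :=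
      contDiffOn_zero.2 (continuousOn_const.mul (hs.continuousOn_shear hP))
    exact_mod_cast contDiffOn_succ_of_hasDerivWithinAt (contDiffOn_succ_of_hasDerivWithinAt
      (contDiffOn_succ_of_hasDerivWithinAt c0 hs.hasDeriv_two) hs.hasDeriv_one) hs.hasDeriv_zero
  · refine (((hs.hasDeriv_three x hx).const_mul lam).congr_of_mem (fun t ht => ?_) hx).congr_deriv ?_
    · rw [e3 t ht, shear]
      ring
    · rw [e1 x hx]
      ring

lemma isEigenvalue_iff_exists_eigenSol {P : ℝ → ℝ} (hP : SymmetricWeight P) {β lam : ℝ}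
    (hβ : 0 < β) (hlam : lam ≠ 0) : IsEigenvalue P 0 β lam ↔ ∃ s, EigenSol P β lam s := by
  constructor
  · rintro ⟨y, ⟨x, hx, hyx⟩, hy, hb1, hb2, hb3, hb4⟩
    have hs := hy.beamSol hlam
    refine ⟨_, ⟨hs, fun h0 => hyx ?_, ?_, ?_⟩, ?_, ?_⟩
    · have z : BeamSol P lam (fun x => (0:ℝ) • _) := hs.smul 0
      exact congrFun (hs.eqOn hP z (by simpa using h0) hx) 0 |>.trans (by simp)
    · have : Y3 y 0 = 0 := by simpa [hβ.ne'] using hb2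
      simp [shear, this]
    · have : Y3 y 1 = 0 := by simpa [hβ.ne'] using hb4
      simp [shear, this]
    · simp; linarith
    · simp; linarith
  · rintro ⟨s, hs⟩
    obtain ⟨hsol, hY⟩ := hs.free.sol.solutionOn hP
    obtain ⟨a1, a2, a3⟩ := hY 0 (by simp)
    obtain ⟨b1, b2, b3⟩ := hY 1 (by simp)
    refine ⟨fun x => s x 0, ?_, hsol, ?_, ?_, ?_, ?_⟩
    · by_contra hcon
      simp only [Nontrivial01, not_exists, not_and, not_not] at hcon
      refine hs.free.ne ?_
      have hz : BeamSol P lam fun _ => 0 := by simpa using hs.free.sol.smul 0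
      have hu : UniqueDiffOn ℝ (Icc (0:ℝ) 1) := uniqueDiffOn_Icc zero_lt_one
      have m0 : (0:ℝ) ∈ Icc (0:ℝ) 1 := by simp
      have z1 : ∀ x ∈ Icc (0:ℝ) 1, s x 1 = 0 := fun x hx => by
        rw [← (hs.free.sol.hasDeriv_zero x hx).derivWithin (hu x hx),
          derivWithin_congr hcon (hcon x hx)]
        simp
      have z2 : ∀ x ∈ Icc (0:ℝ) 1, s x 2 = 0 := fun x hx => by
        rw [← (hs.free.sol.hasDeriv_one x hx).derivWithin (hu x hx),
          derivWithin_congr z1 (z1 x hx)]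
        simp
      have z3 : s 0 3 = 0 := by simpa [shear, hP.zero] using hs.free.shear_zero
      ext i
      fin_cases i
      exacts [hcon 0 m0, z1 0 m0, z2 0 m0, z3]
    · rw [a1, a2, hs.left]; ring
    · rw [a3, hs.free.shear_zero]; ring
    · rw [b1, b2, hs.right]; ring
    · rw [b3, hs.free.shear_one]; ring

lemma EigenSol.param_nonneg {P : ℝ → ℝ} (hP : SymmetricWeight P) {β lam : ℝ} (hβ : 0 < β)
    {s : ℝ → Fin 4 → ℝ} (hs : EigenSol P β lam s) : 0 ≤ lam := by
  by_contra! hlam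
  have hsol := hs.free.sol
  have h3 : s 0 3 = 0 := by simpa [shear, hP.zero] using hs.free.shear_zero
  have hcont : ContinuousOn (fun x => s x 1 * s x 0 + s x 0 * s x 1) (Icc 0 1) :=
    ((hsol.continuousOn_apply 1).mul (hsol.continuousOn_apply 0)).add
      ((hsol.continuousOn_apply 0).mul (hsol.continuousOn_apply 1))
  obtain ⟨C, hC⟩ := isCompact_Icc.exists_bound_of_continuousOn hcont
  have key : ∀ {c d m : ℝ}, 0 ≤ c → c ≤ d → d ≤ 1 → (∀ x ∈ Icc c d, m ≤ s x 0 * s x 0) →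
      m * (P d - P c) ≤ (shear P s d * s d 0 - s d 2 * s d 1 / lam) -
        (shear P s c * s c 0 - s c 2 * s c 1 / lam) := by
    intro c d m hc hcd hd hm
    have hsub : Icc c d ⊆ Icc (0:ℝ) 1 := Icc_subset_Icc hc hd
    refine (le_stieltjes_increment (P := P) (h := fun x => s x 0 * s x 0)
      (h1 := fun x => s x 1 * s x 0 + s x 0 * s x 1)
      (G := fun x => s x 3 * s x 0 - s x 2 * s x 1 / lam) hcd (hP.mono.mono hsub)
      (fun x hx => ((hsol.hasDeriv_zero x (hsub hx)).mul (hsol.hasDeriv_zero x (hsub hx))).mono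
        hsub)
      (fun x hx => (((hsol.hasDeriv_three x (hsub hx)).mul (hsol.hasDeriv_zero x (hsub hx))).sub
        (((hsol.hasDeriv_two x (hsub hx)).mul (hsol.hasDeriv_one x (hsub hx))).div_const
          lam)).mono hsub)
      (fun x hx => ?_) (fun x hx => hC x (hsub hx)) hm).trans_eq ?_
    · have h1 : (lam * shear P s x * s x 1 + s x 2 * s x 2) / lam
          = shear P s x * s x 1 + s x 2 * s x 2 / lam := by
        field_simp [hlam.ne]
      have h2 : s x 2 * s x 2 / lam ≤ 0 := div_nonpos_of_nonneg_of_nonpos (mul_self_nonneg _) hlam.le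
      rw [h1, shear]
      linarith
    · simp only [shear]
      ring
  have htot := key (c := 0) (d := 1) (m := 0) le_rfl zero_le_one le_rfl fun x _ => mul_self_nonneg _
  rw [hs.free.shear_zero, hs.free.shear_one, hs.left, hs.right] at htot
  have hquot : (β * s 1 1 ^ 2 + β * s 0 1 ^ 2) / lam = -(-β * s 1 1 * s 1 1 / lam) +
      β * s 0 1 * s 0 1 / lam := by ring
  have hsum : β * s 1 1 ^ 2 + β * s 0 1 ^ 2 ≤ 0 := by
    have : 0 ≤ (β * s 1 1 ^ 2 + β * s 0 1 ^ 2) / lam := by rw [hquot]; linarith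
    by_contra! hcon
    exact absurd (div_neg_of_pos_of_neg hcon hlam) this.not_gt
  have h11 : s 1 1 = 0 := pow_eq_zero_iff two_ne_zero |>.1 <| by
    nlinarith [sq_nonneg (s 1 1), mul_nonneg hβ.le (sq_nonneg (s 1 1)),
      mul_nonneg hβ.le (sq_nonneg (s 0 1))]
  have h01 : s 0 1 = 0 := pow_eq_zero_iff two_ne_zero |>.1 <| by
    nlinarith [sq_nonneg (s 0 1), mul_nonneg hβ.le (sq_nonneg (s 1 1)),
      mul_nonneg hβ.le (sq_nonneg (s 0 1))]
  have h00 : 0 < s 0 0 * s 0 0 := by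
    refine mul_self_pos.2 fun h00 => hs.free.ne ?_
    ext i
    fin_cases i
    exacts [h00, h01, by simpa [h01] using hs.left, h3]
  obtain ⟨δ, hδ, hδpos⟩ := exists_forall_Icc_lt
    ((hsol.continuousOn_apply 0).mul (hsol.continuousOn_apply 0)) (half_lt_self h00)
  have k1 := key (m := s 0 0 * s 0 0 / 2) le_rfl hδ.1.le hδ.2 fun x hx => (hδpos x hx).le
  have k2 := key (m := 0) hδ.1.le hδ.2 le_rfl fun x _ => mul_self_nonneg _
  rw [hs.free.shear_zero, h01, hP.zero] at k1
  rw [hs.free.shear_one, h11] at k2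
  have := mul_pos (half_pos h00) (hP.pos δ hδ)
  simp only [zero_mul, mul_zero, zero_div, sub_zero] at k1 k2
  linarith

lemma isEigenvalue_zero {P : ℝ → ℝ} (hP : SymmetricWeight P) (β : ℝ) : IsEigenvalue P 0 β 0 := by
  have hs : BeamSol P 0 fun _ => ![1, 0, 0, 0] := fun x _ => by
    have : beamField P 0 x ![1, 0, 0, 0] = 0 := by
      ext i
      fin_cases i <;> simp [beamField]
    rw [this]
    exact hasDerivWithinAt_const _ _ _
  obtain ⟨hsol, hY⟩ := hs.solutionOn hP
  obtain ⟨a1, a2, a3⟩ := hY 0 (by simp)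
  obtain ⟨b1, b2, b3⟩ := hY 1 (by simp)
  refine ⟨_, ⟨0, by simp, by simp⟩, hsol, ?_, ?_, ?_, ?_⟩
  · rw [a1, a2]; simp
  · rw [a3]; simp
  · rw [b1, b2]; simp
  · rw [b3]; simp

section Enumeration

variable {P : ℝ → ℝ} {β : ℝ} {Λ : ℕ → ℝ}

lemma enumeration_zero (hP : SymmetricWeight P) (hβ : 0 < β) (hmono : StrictMono Λ)
    (hrange : range Λ = {lam | IsEigenvalue P 0 β lam}) : Λ 0 = 0 := by
  have hnn : ∀ lam, IsEigenvalue P 0 β lam → 0 ≤ lam := fun lam h => by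
    by_contra! hlam
    obtain ⟨s, hs⟩ := (isEigenvalue_iff_exists_eigenSol hP hβ hlam.ne).1 h
    exact hlam.not_ge (hs.param_nonneg hP hβ)
  obtain ⟨n, hn⟩ : (0:ℝ) ∈ range Λ := hrange ▸ isEigenvalue_zero hP β
  have h0 : Λ 0 ∈ {lam | IsEigenvalue P 0 β lam} := hrange ▸ mem_range_self 0
  exact le_antisymm (hn ▸ hmono.monotone n.zero_le) (hnn _ h0)

/-- Oscillation theorem: the eigenfunctions of the `n`-th positive eigenvalue have `n` zeros. -/
lemma zeroCount_of_eigenSol (hP : SymmetricWeight P) (hβ : 0 < β) (hmono : StrictMono Λ)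
    (hrange : range Λ = {lam | IsEigenvalue P 0 β lam}) {n : ℕ} (hn : n ≠ 0) {s : ℝ → Fin 4 → ℝ}
    (hs : EigenSol P β (Λ n) s) : zeroCount (fun x => s x 0) 0 1 = n := by
  have h0 := enumeration_zero hP hβ hmono hrange
  obtain ⟨n, rfl⟩ := Nat.exists_eq_succ_of_ne_zero hn
  have hpos : 0 < Λ (n + 1) := h0 ▸ hmono n.succ_pos
  have hd : ∀ lam > 0, shootDefect hP β lam = 0 ↔ lam ∈ range Λ := by
    intro lam hlam
    rw [hrange, mem_ofPred_eq, isEigenvalue_iff_exists_eigenSol hP hβ hlam.ne', shootDefect]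
    constructor
    · exact fun h => ⟨_, freeSol_shootSol hP hβ hlam.le, by simp [shootSol_zero], by linarith⟩
    · rintro ⟨r, hr⟩
      obtain ⟨c, hc, he⟩ := hr.free.exists_eqOn_shootSol hP hβ hlam.le hr.left
      have := hr.right
      rw [he (right_mem_Icc.2 zero_le_one)] at this
      simp only [Pi.smul_apply, smul_eq_mul] at this
      refine (mul_eq_zero.1 ?_).resolve_left hc
      linear_combination this
  obtain ⟨c, hc, he⟩ := hs.free.exists_eqOn_shootSol hP hβ hpos.le hs.left
  rw [← zeroCount_shootSol_of_enumeration hP hβ hmono h0 hd n]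
  refine zeroCount_congr fun t ht => ?_
  rw [he (Ico_subset_Icc_self ht)]
  simp [hc]

end Enumeration

/-! ### Self-similar weights -/

namespace CantorSelfSimilar

variable {P : ℝ → ℝ} {κ : ℕ} {a : ℝ}

lemma one_lt_natCast (h : CantorSelfSimilar P κ a) : (1:ℝ) < κ := by
  exact_mod_cast h.2.2.2.2.1

lemma scale_pos (h : CantorSelfSimilar P κ a) : 0 < a := h.2.2.2.2.2.1

lemma length_eq (h : CantorSelfSimilar P κ a) : κ * a + (κ - 1) * bb κ a = 1 := by
  have := h.one_lt_natCast
  rw [bb, mul_div_cancel₀ _ (by linarith)]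
  ring

lemma gap_pos (h : CantorSelfSimilar P κ a) : 0 < bb κ a := by
  have h1 := h.one_lt_natCast
  have h2 := (lt_div_iff₀ (by linarith)).1 h.2.2.2.2.2.2.1
  exact div_pos (by linarith) (by linarith)

lemma piece_bounds (h : CantorSelfSimilar P κ a) {k : ℕ} (hk : k < κ) :
    0 ≤ k * (a + bb κ a) ∧ k * (a + bb κ a) + a ≤ 1 := by
  have ha := h.scale_pos
  have hb := h.gap_pos
  have hk' : (k:ℝ) + 1 ≤ κ := by exact_mod_cast hk
  refine ⟨by positivity, ?_⟩
  nlinarith [h.length_eq]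

lemma piece_mem (h : CantorSelfSimilar P κ a) {k : ℕ} (hk : k < κ) {x : ℝ} (hx : x ∈ Icc (0:ℝ) 1) :
    k * (a + bb κ a) + a * x ∈ Icc (0:ℝ) 1 := by
  obtain ⟨h0, h1⟩ := h.piece_bounds hk
  have ha := h.scale_pos
  exact ⟨by nlinarith [hx.1], by nlinarith [hx.2]⟩

lemma gap_subset (h : CantorSelfSimilar P κ a) {k : ℕ} (hk : k + 1 < κ) :
    Icc (k * (a + bb κ a) + a) ((k + 1) * (a + bb κ a)) ⊆ Icc (0:ℝ) 1 := by
  have h0 := (h.piece_bounds (Nat.lt_of_succ_lt hk)).1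
  have h1 := (h.piece_bounds hk).2
  have ha := h.scale_pos
  push_cast at h1
  exact Icc_subset_Icc (by linarith) (by linarith)

lemma eq_on_gap (h : CantorSelfSimilar P κ a) {k : ℕ} (hk : k + 1 < κ) {x : ℝ}
    (hx : x ∈ Icc (k * (a + bb κ a) + a) ((k + 1) * (a + bb κ a))) :
    P x = P (k * (a + bb κ a) + a) := by
  have hb := h.gap_pos
  set u := k * (a + bb κ a) + a
  set v := (k + 1) * (a + bb κ a)
  have huv : u < v := by simp only [u, v]; linarith
  have hcont : ContinuousOn P (Icc u v) := h.1.mono (h.gap_subset hk)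
  have hconst := h.2.2.2.2.2.2.2.2 (k + 1) (Nat.le_add_left 1 k) hk
  have hu : ((k + 1 : ℕ) : ℝ) * (a + bb κ a) - bb κ a = u := by simp only [u]; push_cast; ring
  have hv : ((k + 1 : ℕ) : ℝ) * (a + bb κ a) = v := by simp only [v]; push_cast; ring
  rw [hu, hv] at hconst
  have hm : (u + v) / 2 ∈ Ioo u v := ⟨by linarith, by linarith⟩
  have key : EqOn P (fun _ => P ((u + v) / 2)) (Icc u v) := by
    rw [← closure_Ioo huv.ne]
    exact EqOn.of_subset_closure (fun x hx => hconst x hx _ hm)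
      (by rwa [closure_Ioo huv.ne]) continuousOn_const subset_closure subset_rfl
  rw [key hx, key (left_mem_Icc.2 huv.le)]

lemma apply_piece (h : CantorSelfSimilar P κ a) {k : ℕ} (hk : k < κ) {x : ℝ}
    (hx : x ∈ Icc (0:ℝ) 1) : κ * P (k * (a + bb κ a) + a * x) = P x + k := by
  have m0 : (0:ℝ) ∈ Icc (0:ℝ) 1 := by simp
  have hP0 := h.2.2.1
  suffices hmain : ∀ k : ℕ, k < κ → κ * P (k * (a + bb κ a)) = k by
    obtain ⟨c, hc⟩ := h.2.2.2.2.2.2.2.1 k hk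
    have := hc 0 m0
    rw [mul_zero, add_zero, hmain k hk, hP0] at this
    rw [hc x hx, this, zero_add]
  intro k
  induction k with
  | zero => simp [hP0]
  | succ k ih =>
    intro hk
    have hk' := Nat.lt_of_succ_lt hk
    obtain ⟨c, hc⟩ := h.2.2.2.2.2.2.2.1 k hk'
    have h0 := hc 0 m0
    have h1 := hc 1 (by simp)
    rw [mul_zero, add_zero, ih hk', hP0] at h0
    rw [mul_one, h.2.2.2.1] at h1
    have := h.eq_on_gap hk (x := (k + 1) * (a + bb κ a)) (right_mem_Icc.2 (by linarith [h.gap_pos]))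
    push_cast
    rw [this, h1]
    linarith

lemma apply_gap (h : CantorSelfSimilar P κ a) {k : ℕ} (hk : k + 1 < κ) {x : ℝ}
    (hx : x ∈ Icc (k * (a + bb κ a) + a) ((k + 1) * (a + bb κ a))) : κ * P x = k + 1 := by
  have := h.apply_piece (Nat.lt_of_succ_lt hk) (x := 1) (by simp)
  rw [mul_one, h.2.2.2.1] at this
  rw [h.eq_on_gap hk hx, this, add_comm]

lemma exists_piece_or_gap (h : CantorSelfSimilar P κ a) {x : ℝ} (hx : x ∈ Icc (0:ℝ) 1) :
    (∃ k < κ, ∃ t ∈ Icc (0:ℝ) 1, x = k * (a + bb κ a) + a * t) ∨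
      ∃ k, k + 1 < κ ∧ x ∈ Icc (k * (a + bb κ a) + a) ((k + 1) * (a + bb κ a)) := by
  have ha := h.scale_pos
  have hb := h.gap_pos
  have hl := h.length_eq
  have hκ := h.2.2.2.2.1
  have hab : 0 < a + bb κ a := by linarith
  have hfl := Nat.floor_le (div_nonneg hx.1 hab.le)
  have hlt := Nat.lt_floor_add_one (x / (a + bb κ a))
  set k := ⌊x / (a + bb κ a)⌋₊
  rw [le_div_iff₀ hab] at hfl
  rw [div_lt_iff₀ hab] at hlt
  have hk : k < κ := by
    by_contra! hcon
    have : (κ:ℝ) ≤ k := by exact_mod_cast hcon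
    nlinarith [hx.2]
  by_cases hxa : x ≤ k * (a + bb κ a) + a
  · refine .inl ⟨k, hk, (x - k * (a + bb κ a)) / a, ⟨div_nonneg (by linarith) ha.le, ?_⟩, by field_simp; ring⟩
    rw [div_le_one ha]
    linarith
  · refine .inr ⟨k, ?_, (not_le.1 hxa).le, hlt.le⟩
    by_contra! hcon
    have : (κ:ℝ) ≤ k + 1 := by exact_mod_cast hcon
    nlinarith [hx.2]

lemma add_reflect (h : CantorSelfSimilar P κ a) {x : ℝ} (hx : x ∈ Icc (0:ℝ) 1) :
    P (1 - x) = 1 - P x := by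
  have hl := h.length_eq
  have hκ := h.one_lt_natCast
  have hcont : ContinuousOn (fun x => |P x + P (1 - x) - 1|) (Icc 0 1) :=
    ((h.1.add (h.1.comp (continuousOn_const.sub continuousOn_id)
      fun t ht => ⟨by simpa using ht.2, by simpa using ht.1⟩)).sub continuousOn_const).abs
  obtain ⟨m, hm, hmax⟩ := isCompact_Icc.exists_isMaxOn ⟨x, hx⟩ hcont
  have hmax' : ∀ t ∈ Icc (0:ℝ) 1, |P t + P (1 - t) - 1| ≤ |P m + P (1 - m) - 1| := hmax
  suffices hz : |P m + P (1 - m) - 1| ≤ 0 by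
    have := abs_nonpos_iff.1 ((hmax' x hx).trans hz)
    linarith
  rcases h.exists_piece_or_gap hm with ⟨k, hk, t, ht, rfl⟩ | ⟨k, hk, hmk⟩
  · have e1 := h.apply_piece hk ht
    have ht' : 1 - t ∈ Icc (0:ℝ) 1 := ⟨by linarith [ht.2], by linarith [ht.1]⟩
    have e2 := h.apply_piece (k := κ - 1 - k) (by omega) ht'
    have hc : ((κ - 1 - k : ℕ) : ℝ) = κ - 1 - k := by
      rw [Nat.cast_sub (by omega), Nat.cast_sub (by omega), Nat.cast_one]
    have hpt : ((κ - 1 - k : ℕ) : ℝ) * (a + bb κ a) + a * (1 - t)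
        = 1 - (k * (a + bb κ a) + a * t) := by rw [hc]; linear_combination hl
    rw [hpt, hc] at e2
    have hbound := hmax' t ht
    set g := P (k * (a + bb κ a) + a * t) + P (1 - (k * (a + bb κ a) + a * t)) - 1
    have hg : P t + P (1 - t) - 1 = κ * g := by simp only [g]; linear_combination -e1 - e2
    rw [hg, abs_mul, abs_of_pos (by linarith)] at hbound
    nlinarith
  · have e1 := h.apply_gap hk hmk
    have hc : ((κ - 2 - k : ℕ) : ℝ) = κ - 2 - k := by
      rw [Nat.cast_sub (by omega), Nat.cast_sub (by omega), Nat.cast_ofNat]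
    have e2 := h.apply_gap (k := κ - 2 - k) (x := 1 - m) (by omega)
      ⟨by rw [hc]; nlinarith [hmk.2], by rw [hc]; nlinarith [hmk.1]⟩
    rw [hc] at e2
    refine (abs_nonpos_iff.2 (mul_left_cancel₀ (a := (κ:ℝ)) (by linarith) ?_))
    linear_combination e1 + e2

lemma pos (h : CantorSelfSimilar P κ a) {x : ℝ} (hx : x ∈ Ioc (0:ℝ) 1) : 0 < P x := by
  have ha := h.scale_pos
  have hκ := h.one_lt_natCast
  have ha1 : a < 1 := by nlinarith [h.length_eq, h.gap_pos]
  have hmem : ∀ n : ℕ, a ^ n ∈ Icc (0:ℝ) 1 := fun n => ⟨by positivity, pow_le_one₀ ha.le ha1.le⟩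
  have hpow : ∀ n : ℕ, 0 < P (a ^ n) := by
    intro n
    induction n with
    | zero => simp [h.2.2.2.1]
    | succ n ih =>
      have := h.apply_piece (k := 0) (by linarith [h.2.2.2.2.1]) (hmem n)
      simp only [Nat.cast_zero, zero_mul, zero_add, add_zero] at this
      rw [← pow_succ'] at this
      rw [← this] at ih
      exact (mul_pos_iff_of_pos_left (by linarith)).1 ih
  obtain ⟨n, hn⟩ := exists_pow_lt_of_lt_one hx.1 ha1
  exact (hpow n).trans_le (h.2.1 (hmem n) (Ioc_subset_Icc_self hx) hn.le)

lemma symmetricWeight (h : CantorSelfSimilar P κ a) : SymmetricWeight P where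
  cont := h.1
  mono := h.2.1
  zero := h.2.2.1
  one := h.2.2.2.1
  symm _ := h.add_reflect
  pos _ := h.pos

end CantorSelfSimilar

/-! ### Rescaling and gluing eigenfunctions -/

lemma zeroCount_comp_affine (f : ℝ → ℝ) (c : ℝ) {a : ℝ} (ha : 0 < a) :
    zeroCount (fun t => f (c + a * t)) 0 1 = zeroCount f c (c + a) := by
  have hinj : Function.Injective fun t : ℝ => c + a * t := fun t t' h =>
    mul_left_cancel₀ ha.ne' (add_left_cancel h)
  rw [zeroCount, zeroCount, ← hinj.encard_image]
  congr 1
  ext x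
  simp only [mem_image, mem_ofPred_eq, mem_Ico]
  constructor
  · rintro ⟨t, ⟨⟨h0, h1⟩, hf⟩, rfl⟩
    exact ⟨⟨by nlinarith, by nlinarith⟩, hf⟩
  · rintro ⟨⟨h0, h1⟩, hf⟩
    have hx : c + a * ((x - c) / a) = x := by field_simp; ring
    refine ⟨(x - c) / a, ⟨⟨div_nonneg (by linarith) ha.le, ?_⟩, by rwa [hx]⟩, hx⟩
    rw [div_lt_one ha]
    linarith

lemma eq_left_of_hasDerivWithinAt_zero {f : ℝ → ℝ} {u v : ℝ}
    (h : ∀ x ∈ Icc u v, HasDerivWithinAt f 0 (Icc u v) x) {x : ℝ} (hx : x ∈ Icc u v) :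
    f x = f u :=
  constant_of_derivWithin_zero (fun x hx => (h x hx).differentiableWithinAt)
    (fun x hx => (h x (Ico_subset_Icc_self hx)).derivWithin
      (uniqueDiffOn_Icc (hx.1.trans_lt hx.2) x (Ico_subset_Icc_self hx))) x hx

lemma EigenSol.reflect {P : ℝ → ℝ} (hP : SymmetricWeight P) {β lam : ℝ} {s : ℝ → Fin 4 → ℝ}
    (hs : EigenSol P β lam s) : EigenSol P β lam (reflectSol s) where
  free := hs.free.reflect hP
  left := by simp [reflectSol, hs.right]
  right := by simp [reflectSol, hs.left]

lemma EigenSol.of_apply_zero_eq {P : ℝ → ℝ} (hP : SymmetricWeight P) {β lam : ℝ}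
    {r s : ℝ → Fin 4 → ℝ} (hs : EigenSol P β lam s) (hr : BeamSol P lam r) (h : r 0 = s 0) :
    EigenSol P β lam r := by
  have h1 := hr.eqOn hP hs.free.sol h (x := 1) (by simp)
  refine ⟨⟨hr, h ▸ hs.free.ne, ?_, ?_⟩, h ▸ hs.left, h1 ▸ hs.right⟩
  · rw [shear, h]
    exact hs.free.shear_zero
  · rw [shear, h1]
    exact hs.free.shear_one

/-- On an interval where the weight is constant, a solution without shear is quadratic. -/
lemma BeamSol.eq_on_gap {P : ℝ → ℝ} {lam : ℝ} {s : ℝ → Fin 4 → ℝ} (hs : BeamSol P lam s) {u v : ℝ}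
    (hsub : Icc u v ⊆ Icc 0 1) (hconst : ∀ x ∈ Icc u v, P x = P u) (hu : shear P s u = 0)
    {x : ℝ} (hx : x ∈ Icc u v) : shear P s x = 0 ∧ s x 2 = s u 2 ∧
      s x 1 = s u 1 + s u 2 * (x - u) ∧
        s x 0 = s u 0 + s u 1 * (x - u) + s u 2 * (x - u) ^ 2 / 2 := by
  have hsh : ∀ x ∈ Icc u v, shear P s x = 0 := by
    intro x hx
    have := eq_left_of_hasDerivWithinAt_zero (f := fun x => P u * s x 0 + s x 3) (fun x hx =>
      (((hs.hasDeriv_zero x (hsub hx)).const_mul (P u)).add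
        (hs.hasDeriv_three x (hsub hx))).mono hsub |>.congr_deriv
          (by rw [hconst x hx]; ring)) hx
    rw [shear, hconst x hx, this]
    exact hu
  have h2 : ∀ x ∈ Icc u v, s x 2 = s u 2 := fun x hx =>
    eq_left_of_hasDerivWithinAt_zero (f := fun x => s x 2) (fun x hx =>
      (hs.hasDeriv_two x (hsub hx)).mono hsub |>.congr_deriv (by rw [hsh x hx, mul_zero])) hx
  have hlin : ∀ x, HasDerivWithinAt (fun x => x - u) 1 (Icc u v) x := fun x =>
    (hasDerivWithinAt_id x _).sub_const u
  have h1 : ∀ x ∈ Icc u v, s x 1 = s u 1 + s u 2 * (x - u) := by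
    intro x hx
    have := eq_left_of_hasDerivWithinAt_zero (f := fun x => s x 1 - s u 2 * (x - u)) (fun x hx =>
      ((hs.hasDeriv_one x (hsub hx)).mono hsub).sub ((hlin x).const_mul (s u 2)) |>.congr_deriv
        (by rw [h2 x hx]; ring)) hx
    simp only [sub_self, mul_zero, sub_zero] at this
    linarith
  refine ⟨hsh x hx, h2 x hx, h1 x hx, ?_⟩
  have := eq_left_of_hasDerivWithinAt_zero
    (f := fun x => s x 0 - s u 1 * (x - u) - s u 2 / 2 * (x - u) ^ 2) (fun x hx =>
      (((hs.hasDeriv_zero x (hsub hx)).mono hsub).sub ((hlin x).const_mul (s u 1))).sub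
        (((hlin x).pow 2).const_mul (s u 2 / 2)) |>.congr_deriv (by rw [h1 x hx]; ring)) hx
  simp only [sub_self, mul_zero, sub_zero, zero_pow two_ne_zero] at this
  linarith

/-- The restriction of a solution to the `k`-th piece of the support, rescaled to `[0,1]`. -/
noncomputable def pieceSol (κ : ℕ) (a : ℝ) (k : ℕ) (s : ℝ → Fin 4 → ℝ) (x : ℝ) : Fin 4 → ℝ :=
  ![s (k * (a + bb κ a) + a * x) 0, a * s (k * (a + bb κ a) + a * x) 1,
    a ^ 2 * s (k * (a + bb κ a) + a * x) 2,
    k * s (k * (a + bb κ a) + a * x) 0 + κ * s (k * (a + bb κ a) + a * x) 3]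

namespace CantorSelfSimilar

variable {P : ℝ → ℝ} {κ : ℕ} {a : ℝ}

lemma shear_pieceSol (h : CantorSelfSimilar P κ a) {k : ℕ} (hk : k < κ) (s : ℝ → Fin 4 → ℝ) {x : ℝ}
    (hx : x ∈ Icc (0:ℝ) 1) :
    shear P (pieceSol κ a k s) x = κ * shear P s (k * (a + bb κ a) + a * x) := by
  have := h.apply_piece hk hx
  simp only [shear, pieceSol, Matrix.cons_val]
  linear_combination -s (k * (a + bb κ a) + a * x) 0 * this

lemma beamSol_pieceSol (h : CantorSelfSimilar P κ a) {k : ℕ} (hk : k < κ) {lam mu : ℝ}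
    (hlam : a ^ 3 * lam = κ * mu) {s : ℝ → Fin 4 → ℝ} (hs : BeamSol P lam s) :
    BeamSol P mu (pieceSol κ a k s) := by
  intro x hx
  have hz := h.piece_mem hk hx
  have hd : HasDerivWithinAt (fun x => k * (a + bb κ a) + a * x) a (Icc 0 1) x := by
    simpa using ((hasDerivWithinAt_id x (Icc 0 1)).const_mul a).const_add (k * (a + bb κ a))
  have hmaps : MapsTo (fun x => k * (a + bb κ a) + a * x) (Icc 0 1) (Icc 0 1) :=
    fun t ht => h.piece_mem hk ht
  have d0 := (hs.hasDeriv_zero _ hz).comp x hd hmaps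
  have d1 := (hs.hasDeriv_one _ hz).comp x hd hmaps
  have d2 := (hs.hasDeriv_two _ hz).comp x hd hmaps
  have d3 := (hs.hasDeriv_three _ hz).comp x hd hmaps
  have hp := h.apply_piece hk hx
  have hsh := h.shear_pieceSol hk s hx
  rw [shear] at hsh
  rw [hasDerivWithinAt_pi]
  intro i
  fin_cases i
  · exact d0.congr_deriv (mul_comm _ _)
  · refine (d1.const_mul a).congr_deriv ?_
    simp only [beamField, pieceSol, Fin.mk_one, Matrix.cons_val]
    ring
  · refine (d2.const_mul (a ^ 2)).congr_deriv ?_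
    simp only [beamField, Fin.reduceFinMk, Matrix.cons_val]
    rw [hsh]
    linear_combination shear P s (k * (a + bb κ a) + a * x) * hlam
  · refine ((d0.const_mul (k:ℝ)).add (d3.const_mul (κ:ℝ))).congr_deriv ?_
    simp only [beamField, pieceSol, Fin.reduceFinMk, Matrix.cons_val]
    linear_combination -a * s (k * (a + bb κ a) + a * x) 1 * hp

/-- An eigenfunction on one piece continues across the adjacent gap, without zeros there, to the
reflected eigenfunction on the next piece. -/
lemma eigenSol_pieceSol_succ (h : CantorSelfSimilar P κ a) {k : ℕ} (hk : k + 1 < κ) {lam mu : ℝ}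
    (hmu : 0 < mu) (hlam : a ^ 3 * lam = κ * mu) {s : ℝ → Fin 4 → ℝ} (hs : BeamSol P lam s)
    (hk' : EigenSol P (2 * a / bb κ a) mu (pieceSol κ a k s)) :
    EigenSol P (2 * a / bb κ a) mu (pieceSol κ a (k + 1) s) ∧
      zeroCount (fun x => s x 0) (k * (a + bb κ a) + a) ((k + 1 : ℕ) * (a + bb κ a)) = 0 := by
  have hP := h.symmetricWeight
  have ha := h.scale_pos
  have hb := h.gap_pos
  have hκ := h.one_lt_natCast
  have hsub := h.gap_subset hk
  have hconst := fun x => h.eq_on_gap hk (x := x)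
  have hshear := h.shear_pieceSol (Nat.lt_of_succ_lt hk) s (x := 1) (by simp)
  rw [hk'.free.shear_one, mul_one, eq_comm, mul_eq_zero, or_iff_right (by linarith)] at hshear
  have hsign := hk'.free.mul_pos_of_boundary hP hmu (by positivity) hk'.right
  have hright := hk'.right
  have hr0 : reflectSol (pieceSol κ a k s) 0 3 = 0 := by
    have := hk'.free.shear_one
    simp only [shear, hP.one] at this
    simp only [reflectSol, sub_zero, Matrix.cons_val]
    linarith
  simp only [pieceSol, mul_one, Matrix.cons_val] at hsign hright
  have hgap := fun x => hs.eq_on_gap hsub hconst hshear (x := x)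
  have hv : ((k + 1 : ℕ) : ℝ) * (a + bb κ a) = k * (a + bb κ a) + a + bb κ a := by
    push_cast; ring
  have hv' : ((k:ℝ) + 1) * (a + bb κ a) = k * (a + bb κ a) + a + bb κ a := by ring
  rw [hv'] at hgap
  have hp := h.apply_piece hk (x := 0) (by simp)
  rw [mul_zero, add_zero, hv, hP.zero, zero_add] at hp
  have hstart : pieceSol κ a (k + 1) s 0 = ![s (k * (a + bb κ a) + a + bb κ a) 0,
      a * s (k * (a + bb κ a) + a + bb κ a) 1, a ^ 2 * s (k * (a + bb κ a) + a + bb κ a) 2,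
      (k + 1 : ℕ) * s (k * (a + bb κ a) + a + bb κ a) 0 +
        κ * s (k * (a + bb κ a) + a + bb κ a) 3] := by
    rw [pieceSol, mul_zero, add_zero, hv]
  have hrefl : reflectSol (pieceSol κ a k s) 0 = ![s (k * (a + bb κ a) + a) 0,
      -(a * s (k * (a + bb κ a) + a) 1), a ^ 2 * s (k * (a + bb κ a) + a) 2, 0] := by
    ext i
    fin_cases i
    exacts [by simp [reflectSol, pieceSol], by simp [reflectSol, pieceSol],
      by simp [reflectSol, pieceSol], hr0]
  rw [hv]
  set u := k * (a + bb κ a) + a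
  set b := bb κ a
  have hE : s u 2 * b = -2 * s u 1 := by
    field_simp at hright
    linarith
  have hD : 0 < s u 0 * s u 1 := by
    have : 0 < a * (s u 0 * s u 1) := by linarith
    exact (mul_pos_iff_of_pos_left ha).1 this
  obtain ⟨g3, g2, g1, g0⟩ := hgap (u + b) ⟨by linarith, le_rfl⟩
  rw [add_sub_cancel_left] at g0 g1
  constructor
  · refine (hk'.reflect hP).of_apply_zero_eq hP (h.beamSol_pieceSol hk hlam hs) ?_
    rw [shear] at g3
    have f0 : s (u + b) 0 = s u 0 := by rw [g0]; linear_combination b / 2 * hE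
    have f1 : a * s (u + b) 1 = -(a * s u 1) := by rw [g1]; linear_combination a * hE
    have f3 : (k + 1 : ℕ) * s (u + b) 0 + κ * s (u + b) 3 = 0 := by
      linear_combination κ * g3 - s (u + b) 0 * hp
    rw [hstart, hrefl, f3, f1, g2, f0]
  · refine zeroCount_eq_zero fun t ht h0 => ?_
    have g := (hgap t (Ico_subset_Icc_self ht)).2.2.2
    have ht0 : 0 ≤ t - u := by linarith [ht.1]
    have ht1 : 0 < b - (t - u) := by linarith [ht.2]
    have : b * s u 0 ^ 2 + s u 0 * s u 1 * ((t - u) * (b - (t - u))) = 0 := by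
      linear_combination b * s u 0 * h0 - b * s u 0 * g - s u 0 * (t - u) ^ 2 / 2 * hE
    have h1 : 0 < s u 0 ^ 2 := by
      have : s u 0 ≠ 0 := fun h => by simp [h] at hD
      positivity
    have h2 : 0 ≤ s u 0 * s u 1 * ((t - u) * (b - (t - u))) := by positivity
    nlinarith [mul_pos hb h1]

lemma exists_eigenSol_of_eigenSol (h : CantorSelfSimilar P κ a) {lam mu : ℝ} (hmu : 0 < mu)
    (hlam : a ^ 3 * lam = κ * mu) {n : ℕ} {r : ℝ → Fin 4 → ℝ}
    (hr : EigenSol P (2 * a / bb κ a) mu r)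
    (hn : ∀ r, EigenSol P (2 * a / bb κ a) mu r → zeroCount (fun x => r x 0) 0 1 = n) :
    ∃ s, EigenSol P (2 / bb κ a) lam s ∧ zeroCount (fun x => s x 0) 0 1 = (κ * n : ℕ) := by
  have hP := h.symmetricWeight
  have ha := h.scale_pos
  have hb := h.gap_pos
  have hκ := h.one_lt_natCast
  have hκ2 := h.2.2.2.2.1
  obtain ⟨s, hs0, hs⟩ := exists_beamSol hP lam ![r 0 0, r 0 1 / a, r 0 2 / a ^ 2, 0]
  have h3 : r 0 3 = 0 := by simpa [shear, hP.zero] using hr.free.shear_zero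
  have key : ∀ k : ℕ, k < κ → EigenSol P (2 * a / bb κ a) mu (pieceSol κ a k s) ∧
      zeroCount (fun x => s x 0) 0 (k * (a + bb κ a) + a) = ((k + 1) * n : ℕ) := by
    intro k hk
    have hcount := zeroCount_comp_affine (fun x => s x 0) (k * (a + bb κ a)) ha
    induction k with
    | zero =>
      have h0 : EigenSol P (2 * a / bb κ a) mu (pieceSol κ a 0 s) := by
        refine hr.of_apply_zero_eq hP (h.beamSol_pieceSol hk hlam hs) ?_
        ext i
        fin_cases i <;> simp [pieceSol, hs0, h3] <;> field_simp
      refine ⟨h0, ?_⟩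
      have := hn _ h0
      simp only [pieceSol, Matrix.cons_val] at this
      rw [this, Nat.cast_zero, zero_mul, zero_add] at hcount
      rw [Nat.cast_zero, zero_mul, zero_add, ← hcount, zero_add, one_mul]
    | succ k ih =>
      obtain ⟨hE, hc⟩ := ih (Nat.lt_of_succ_lt hk) (zeroCount_comp_affine (fun x => s x 0) _ ha)
      obtain ⟨hE', hc'⟩ := h.eigenSol_pieceSol_succ hk hmu hlam hs hE
      refine ⟨hE', ?_⟩
      have h0 := (h.piece_bounds (Nat.lt_of_succ_lt hk)).1
      have := hn _ hE'
      simp only [pieceSol, Matrix.cons_val] at this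
      rw [this] at hcount
      rw [zeroCount_add _ (v := (k + 1 : ℕ) * (a + bb κ a)) (by positivity) (by linarith),
        zeroCount_add _ (v := k * (a + bb κ a) + a) (by positivity) (by push_cast; linarith), hc,
        hc', ← hcount]
      push_cast
      ring
  obtain ⟨h0, -⟩ := key 0 (by omega)
  obtain ⟨h1, hc⟩ := key (κ - 1) (by omega)
  have hend : ((κ - 1 : ℕ) : ℝ) * (a + bb κ a) + a = 1 := by
    rw [Nat.cast_sub (by omega), Nat.cast_one]
    linear_combination h.length_eq
  have hsh0 := h.shear_pieceSol (k := 0) (by omega) s (x := 0) (by simp)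
  have hsh1 := h.shear_pieceSol (k := κ - 1) (by omega) s (x := 1) (by simp)
  rw [h0.free.shear_zero, Nat.cast_zero, zero_mul, mul_zero, add_zero, eq_comm, mul_eq_zero,
    or_iff_right (by linarith)] at hsh0
  rw [h1.free.shear_one, mul_one, hend, eq_comm, mul_eq_zero, or_iff_right (by linarith)] at hsh1
  have hl := h0.left
  have hr := h1.right
  simp only [pieceSol, Nat.cast_zero, zero_mul, mul_zero, add_zero, mul_one, hend,
    Matrix.cons_val] at hl hr
  refine ⟨s, ⟨⟨hs, fun hz => h0.free.ne ?_, hsh0, hsh1⟩, ?_, ?_⟩, ?_⟩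
  · ext i
    fin_cases i <;> simp [pieceSol, hz]
  · field_simp at hl ⊢
    linarith
  · field_simp at hr ⊢
    linarith
  · rw [hend, Nat.sub_add_cancel (by omega)] at hc
    exact hc

end CantorSelfSimilar

theorem stmt10 (P : ℝ → ℝ) (κ : ℕ) (a : ℝ) (hP : CantorSelfSimilar P κ a)
    (Λ M : ℕ → ℝ) (hΛmono : StrictMono Λ)
    (hΛrange : Set.range Λ = {lam : ℝ | IsEigenvalue P 0 (2 / bb κ a) lam})
    (hMmono : StrictMono M)
    (hMrange : Set.range M = {lam : ℝ | IsEigenvalue P 0 (2 * a / bb κ a) lam}) :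
    ∀ n : ℕ, Λ (κ * n) = (κ / a ^ 3) * M n := by
  intro n
  have hW := hP.symmetricWeight
  have ha := hP.scale_pos
  have hb := hP.gap_pos
  have hκ := hP.one_lt_natCast
  have hβ : 0 < 2 / bb κ a := by positivity
  have hβ' : 0 < 2 * a / bb κ a := by positivity
  have hΛ0 := enumeration_zero hW hβ hΛmono hΛrange
  have hM0 := enumeration_zero hW hβ' hMmono hMrange
  rcases Nat.eq_zero_or_pos n with rfl | hn
  · rw [mul_zero, hΛ0, hM0, mul_zero]
  have hmu : 0 < M n := hM0 ▸ hMmono hn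
  have hlam : 0 < κ / a ^ 3 * M n := by positivity
  obtain ⟨r, hr⟩ := (isEigenvalue_iff_exists_eigenSol hW hβ' hmu.ne').1
    (hMrange ▸ mem_range_self n : M n ∈ {lam : ℝ | IsEigenvalue P 0 (2 * a / bb κ a) lam})
  obtain ⟨s, hs, hcount⟩ := hP.exists_eigenSol_of_eigenSol hmu
    (lam := κ / a ^ 3 * M n) (by field_simp) hr
    fun r hr => zeroCount_of_eigenSol hW hβ' hMmono hMrange hn.ne' hr
  obtain ⟨j, hj⟩ : κ / a ^ 3 * M n ∈ range Λ :=
    hΛrange ▸ (isEigenvalue_iff_exists_eigenSol hW hβ hlam.ne').2 ⟨s, hs⟩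
  have hj0 : j ≠ 0 := by
    rintro rfl
    linarith
  rw [← hj] at hs
  rw [zeroCount_of_eigenSol hW hβ hΛmono hΛrange hj0 hs, Nat.cast_inj] at hcount
  rw [← hcount, hj]
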